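/- arXiv:1912.08402 — 2 statements merged into one kernel-verified Lean document; each statement's English description precedes it below -/
import Mathlib

section
/- Let w be an Oleinik solution on [0,X], let 0 < ε < X, let k ≥ 2 be an integer, and assume the induction hypothesis (IH_k) holds on [ε/2,X]×(0,δ₃] for some δ₃ ∈ (0,1) with δ₃ ≤ δ₁. Then for every sufficiently small β ∈ (0,1) there exists a constant M₁ > 0, independent of ψ, such that for all (x,ψ) ∈ [7ε/8,X]×(0,δ₃]: |∂ₓ^k w(x,ψ)| ≤ M₁ ψ^{1−β} and |∂ₓ^k √w(x,ψ)| ≤ M₁ ψ^{1/2−β}. -/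
open Set

/-- Iterated partial derivative `∂ₓ^k ∂_ψ^m w` of a function of two real variables. -/
noncomputable def pd (k m : ℕ) (w : ℝ → ℝ → ℝ) (x ψ : ℝ) : ℝ :=
  iteratedDeriv k (fun x' => iteratedDeriv m (w x') ψ) x

/-- Von Mises formulation of the steady Prandtl equation with favorable pressure:
`w` is an Oleinik solution on `[0,X]` with structural constants `α, m, M, C₀, δ₁`. -/
structure OleinikSolution (X : ℝ) (p : ℝ → ℝ) (w : ℝ → ℝ → ℝ)
    (α m M C₀ δ₁ : ℝ) : Prop where
  hX : 0 < X
  hp : ContDiff ℝ (⊤ : ℕ∞) p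
  hfav : ∀ x : ℝ, deriv p x ≤ 0
  hα : α ∈ Set.Ioo (0 : ℝ) (1 / 2)
  hm : 0 < m
  hmM : m < M
  hC₀ : 0 < C₀
  hδ₁ : δ₁ ∈ Set.Ioo (0 : ℝ) 1
  cont : ContinuousOn (fun z : ℝ × ℝ => w z.1 z.2) (Set.Icc 0 X ×ˢ Set.Ici 0)
  smooth : ContDiffOn ℝ (⊤ : ℕ∞) (fun z : ℝ × ℝ => w z.1 z.2) (Set.Ioc 0 X ×ˢ Set.Ioi 0)
  bdry : ∀ x ∈ Set.Icc (0 : ℝ) X, w x 0 = 0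
  eqn : ∀ x ∈ Set.Ioc (0 : ℝ) X, ∀ ψ ∈ Set.Ioi (0 : ℝ),
    pd 1 0 w x ψ - Real.sqrt (w x ψ) * pd 0 2 w x ψ = -2 * deriv p x
  slope_lb : ∀ x ∈ Set.Icc (0 : ℝ) X, ∀ ψ ∈ Set.Icc (0 : ℝ) δ₁, m < pd 0 1 w x ψ
  slope_ub : ∀ x ∈ Set.Icc (0 : ℝ) X, ∀ ψ ∈ Set.Icc (0 : ℝ) δ₁, pd 0 1 w x ψ < M
  growth_lb : ∀ x ∈ Set.Icc (0 : ℝ) X, ∀ ψ ∈ Set.Ioc (0 : ℝ) δ₁, m * ψ < w x ψ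
  growth_ub : ∀ x ∈ Set.Icc (0 : ℝ) X, ∀ ψ ∈ Set.Ioc (0 : ℝ) δ₁, w x ψ < M * ψ
  dx_bound : ∀ x ∈ Set.Icc (0 : ℝ) X, ∀ ψ ∈ Set.Icc (0 : ℝ) δ₁,
    |pd 1 0 w x ψ| ≤ C₀ * ψ ^ ((1 : ℝ) / 2 + α)

/-- The induction hypothesis `(IH_k)` on a region `R`, with constant `C₁`:
for all `(x,ψ) ∈ R` and all `0 ≤ j ≤ k-1`, `|∂_ψ ∂ₓ^j w| ≤ C₁`,
`|∂_ψ² ∂ₓ^j w| ≤ C₁ ψ⁻¹`, `|∂ₓ^j w| ≤ C₁ ψ`, `|∂ₓ^j √w| ≤ C₁ ψ^{1/2}`,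
and additionally `|∂ₓ^k w| ≤ C₁ ψ^{-1/2}`. -/
def IH (k : ℕ) (w : ℝ → ℝ → ℝ) (R : Set (ℝ × ℝ)) (C₁ : ℝ) : Prop :=
  ∀ z ∈ R,
    (∀ j ≤ k - 1,
      |pd j 1 w z.1 z.2| ≤ C₁ ∧
      |pd j 2 w z.1 z.2| ≤ C₁ * z.2⁻¹ ∧
      |pd j 0 w z.1 z.2| ≤ C₁ * z.2 ∧
      |pd j 0 (fun x' ψ' => Real.sqrt (w x' ψ')) z.1 z.2| ≤ C₁ * z.2 ^ ((1 : ℝ) / 2)) ∧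
    |pd k 0 w z.1 z.2| ≤ C₁ * z.2 ^ (-(1 : ℝ) / 2)

open Filter Topology

namespace OS

lemma second_deriv_test {q : ℝ → ℝ} {a : ℝ} (hq : ContinuousAt q a) (hmax : IsLocalMax q a) :
    deriv (deriv q) a ≤ 0 := by
  by_contra hcon
  push Not at hcon
  have h1 : deriv q a = 0 := hmax.deriv_eq_zero
  have hmin := isLocalMin_of_deriv_deriv_pos hcon h1 hq
  have heq : q =ᶠ[𝓝 a] fun _ => q a := by
    filter_upwards [hmax, hmin] with x h1 h2
    exact le_antisymm h1 h2
  have h2 : deriv q =ᶠ[𝓝 a] deriv (fun _ => q a) := heq.deriv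
  have h3 := h2.deriv_eq
  simp at h3
  linarith

lemma deriv_nonneg_of_left_max {q : ℝ → ℝ} {a b q' : ℝ} (hab : a < b) (hq : HasDerivAt q q' b)
    (hmax : ∀ x ∈ Icc a b, q x ≤ q b) : 0 ≤ q' := by
  have h := (hasDerivAt_iff_tendsto_slope.1 hq).mono_left
    (nhdsWithin_mono b (show Iio b ⊆ {b}ᶜ from fun x hx => ne_of_lt hx))
  refine ge_of_tendsto h ?_
  filter_upwards [Ioo_mem_nhdsLT hab] with x hx
  rw [slope_def_field]
  have := hmax x ⟨hx.1.le, hx.2.le⟩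
  exact div_nonneg_of_nonpos (by linarith) (by linarith [hx.2])

lemma le_rpow_sub {ψ β : ℝ} (h0 : 0 < ψ) (h1 : ψ ≤ 1) (hβ : 0 < β) : ψ ≤ ψ ^ (1 - β) := by
  conv_lhs => rw [← Real.rpow_one ψ]
  exact Real.rpow_le_rpow_of_exponent_ge h0 h1 (by linarith)

/-- Second derivative of the barrier comparison. -/
lemma barrier_test {F : ℝ → ℝ} {a β : ℝ} (ha : 0 < a) (hF : ContDiffAt ℝ 2 F a)
    (hmax : ∀ᶠ y in 𝓝 a, F y * a ^ (1 - β) ≤ F a * y ^ (1 - β)) :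
    deriv (deriv F) a * a ^ 2 ≤ - (β * (1 - β)) * F a := by
  set θ := F a / a ^ (1 - β) with hθ
  have hpos : 0 < a ^ (1 - β) := Real.rpow_pos_of_pos ha _
  have hθa : θ * a ^ (1 - β) = F a := by rw [hθ]; field_simp
  have hpc : ContDiffAt ℝ 2 (fun y : ℝ => θ * y ^ (1 - β)) a :=
    contDiffAt_const.mul (contDiffAt_id.rpow_const_of_ne ha.ne')
  have hloc : IsLocalMax (fun y => F y - θ * y ^ (1 - β)) a := by
    filter_upwards [hmax] with y hy
    have : F y ≤ θ * y ^ (1 - β) := by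
      rw [hθ, div_mul_eq_mul_div, le_div_iff₀ hpos]; exact hy
    rw [hθa]; linarith
  have h2 := second_deriv_test (hF.sub hpc).continuousAt hloc
  have e1 : deriv (fun y => F y - θ * y ^ (1 - β)) =ᶠ[𝓝 a]
      fun y => deriv F y - θ * ((1 - β) * y ^ (1 - β - 1)) := by
    have hFd : ∀ᶠ y in 𝓝 a, ContDiffAt ℝ 2 F y := hF.eventually (by simp)
    filter_upwards [hFd, lt_mem_nhds ha] with y hy hy0
    have d1 : HasDerivAt F (deriv F y) y := (hy.differentiableAt (by simp)).hasDerivAt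
    have d2 : HasDerivAt (fun y : ℝ => y ^ (1 - β)) ((1 - β) * y ^ (1 - β - 1)) y :=
      Real.hasDerivAt_rpow_const (Or.inl hy0.ne')
    exact (d1.sub (d2.const_mul θ)).deriv
  have hF1 : DifferentiableAt ℝ (deriv F) a := by
    have h3 : ContDiffAt ℝ 1 (fderiv ℝ F) a := hF.fderiv_right (m := 1) (by norm_num)
    have h4 : DifferentiableAt ℝ (fun y => fderiv ℝ F y 1) a :=
      (h3.differentiableAt (by simp)).clm_apply (differentiableAt_const _)
    exact h4
  have e2 : deriv (deriv (fun y => F y - θ * y ^ (1 - β))) a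
      = deriv (deriv F) a - θ * ((1 - β) * ((1 - β - 1) * a ^ (1 - β - 1 - 1))) := by
    rw [e1.deriv_eq]
    have d2 : HasDerivAt (fun y : ℝ => y ^ (1 - β - 1)) ((1 - β - 1) * a ^ (1 - β - 1 - 1)) a :=
      Real.hasDerivAt_rpow_const (Or.inl ha.ne')
    exact (hF1.hasDerivAt.sub ((d2.const_mul (1 - β)).const_mul θ)).deriv
  rw [e2] at h2
  have e3 : a ^ (1 - β - 1 - 1) * a ^ 2 = a ^ (1 - β) := by
    rw [← Real.rpow_natCast a 2, ← Real.rpow_add ha]; congr 1; push_cast; ring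
  have h5 : 0 < a ^ 2 := by positivity
  have h6 : (deriv (deriv F) a - θ * ((1 - β) * ((1 - β - 1) * a ^ (1 - β - 1 - 1)))) * a ^ 2 ≤ 0 :=
    mul_nonpos_of_nonpos_of_nonneg h2 h5.le
  have h7 : (deriv (deriv F) a - θ * ((1 - β) * ((1 - β - 1) * a ^ (1 - β - 1 - 1)))) * a ^ 2
     = deriv (deriv F) a * a ^ 2 + β * (1 - β) * (θ * (a ^ (1 - β - 1 - 1) * a ^ 2)) := by ring
  rw [h7, e3, hθa] at h6
  linarith

set_option maxHeartbeats 1000000 in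
lemma core_F {x0 X' δ β μ K C L lam ψ₁ A : ℝ} {F u c g Fx : ℝ → ℝ → ℝ}
    (hδ : δ ≤ 1) (hβ : 0 < β) (hβ1 : β < 1) (hμ : 0 < μ)
    (hK : 0 ≤ K) (hC : 0 ≤ C) (hL : X' - x0 ≤ L) (hL0 : 0 < L) (hψ₁ : 0 < ψ₁) (hψ₁δ : ψ₁ ≤ δ)
    (hlam0 : 0 < lam) (hlam : 4 ≤ lam * (μ * (β * (1 - β))))
    (hKψ : 4 * (K * (ψ₁ * √ψ₁)) ≤ μ * (β * (1 - β)))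
    (hA0 : 0 < A) (hA1 : C * lam ≤ A) (hA2 : 4 * (C * L) ≤ A * (μ * (β * (1 - β))))
    (hA3 : C * L ≤ A * (ψ₁ * √ψ₁))
    (hcont : ContinuousOn (fun z : ℝ × ℝ => F z.1 z.2) (Icc x0 X' ×ˢ Ioc 0 δ))
    (hFx : ∀ x ∈ Icc x0 X', ∀ ψ ∈ Ioo 0 δ, HasDerivAt (fun x => F x ψ) (Fx x ψ) x)
    (hFy : ∀ x ∈ Icc x0 X', ∀ ψ ∈ Ioo 0 δ, ContDiffAt ℝ 2 (F x) ψ)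
    (heq : ∀ x ∈ Icc x0 X', ∀ ψ ∈ Ioo 0 δ,
      Fx x ψ = u x ψ * deriv (deriv (F x)) ψ + c x ψ * F x ψ + g x ψ)
    (hu : ∀ x ∈ Icc x0 X', ∀ ψ ∈ Ioo 0 δ, μ * √ψ ≤ u x ψ)
    (hc : ∀ x ∈ Icc x0 X', ∀ ψ ∈ Ioo 0 δ, c x ψ ≤ K)
    (hg : ∀ x ∈ Icc x0 X', ∀ ψ ∈ Ioo 0 δ, |g x ψ| * √ψ ≤ C)
    (hF1 : ∀ x ∈ Icc x0 X', ∀ ψ ∈ Ioc 0 δ, |F x ψ| * √ψ ≤ C)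
    (hF2 : ∃ C', ∀ x ∈ Icc x0 X', ∀ ψ ∈ Ioc 0 δ, |F x ψ| ≤ C' * ψ) :
    ∀ x ∈ Icc x0 X', ∀ ψ ∈ Ioc 0 δ, F x ψ * (x - x0) ≤ A * ψ ^ (1 - β) := by
  by_contra hcon
  push Not at hcon
  obtain ⟨xb, hxb, ψb, hψb, hbad⟩ := hcon
  obtain ⟨C', hC'⟩ := hF2
  set κ := μ * (β * (1 - β)) with hκ
  have hκ0 : 0 < κ := by have : 0 < 1 - β := by linarith
                         positivity
  have hδ0 : 0 < δ := lt_of_lt_of_le hψ₁ hψ₁δ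
  -- small ψ
  obtain ⟨η, hη0, hη⟩ : ∃ η > 0, ∀ ψ, 0 < ψ → ψ ≤ η → C' * L * ψ ^ β ≤ A := by
    have ht : Tendsto (fun ψ : ℝ => C' * L * ψ ^ β) (𝓝[>] 0) (𝓝 0) := by
      have h1 : ContinuousAt (fun ψ : ℝ => C' * L * ψ ^ β) 0 :=
        (Real.continuousAt_rpow_const 0 β (Or.inr hβ.le)).const_mul _
      have h2 := h1.tendsto
      simp only [Real.zero_rpow hβ.ne', mul_zero] at h2
      exact h2.mono_left nhdsWithin_le_nhds
    have h3 : ∀ᶠ ψ in 𝓝[>] (0 : ℝ), C' * L * ψ ^ β ≤ A := ht.eventually_le_const hA0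
    obtain ⟨η, h4, h5⟩ := (mem_nhdsGT_iff_exists_Ioc_subset).1 h3
    exact ⟨η, h4, fun ψ h0 h1 => h5 ⟨h0, h1⟩⟩
  have hsmall : ∀ x ∈ Icc x0 X', ∀ ψ ∈ Ioc 0 δ, ψ ≤ η → F x ψ * (x - x0) ≤ A * ψ ^ (1 - β) := by
    intro x hx ψ hψ hle
    have h1 := hC' x hx ψ hψ
    have h2 := hη ψ hψ.1 hle
    have h3 : F x ψ * (x - x0) ≤ (C' * ψ) * L := by
      have : 0 ≤ x - x0 := by linarith [hx.1]
      have : x - x0 ≤ L := by linarith [hx.2]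
      have h5 : 0 ≤ C' * ψ := le_trans (abs_nonneg _) h1
      calc F x ψ * (x - x0) ≤ (C' * ψ) * (x - x0) := by gcongr; exact le_trans (le_abs_self _) h1
        _ ≤ _ := by gcongr
    have h4 : ψ = ψ ^ β * ψ ^ (1 - β) := by
      rw [← Real.rpow_add hψ.1]; simp
    calc F x ψ * (x - x0) ≤ (C' * ψ) * L := h3
      _ = (C' * L) * ψ := by ring
      _ = (C' * L * ψ ^ β) * ψ ^ (1 - β) := by conv_lhs => rw [h4]
                                               ring
      _ ≤ _ := mul_le_mul_of_nonneg_right h2 (Real.rpow_nonneg hψ.1.le _)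
  have hηb : η < ψb := by
    by_contra hh
    push Not at hh
    exact absurd (hsmall xb hxb ψb hψb hh) (not_le.2 hbad)
  have hsub : Icc x0 X' ×ˢ Icc η δ ⊆ Icc x0 X' ×ˢ Ioc 0 δ := by
    rintro ⟨x, ψ⟩ ⟨h1, h2⟩
    exact ⟨h1, lt_of_lt_of_le hη0 h2.1, h2.2⟩
  have hΦ : ContinuousOn (fun z : ℝ × ℝ => F z.1 z.2 * (z.1 - x0) / z.2 ^ (1 - β))
      (Icc x0 X' ×ˢ Icc η δ) := by
    refine ((hcont.mono hsub).mul (by fun_prop)).div ?_ ?_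
    · intro z hz
      exact (ContinuousAt.rpow_const continuousAt_snd
        (Or.inl (hsub hz).2.1.ne')).continuousWithinAt
    · intro z hz
      exact (Real.rpow_pos_of_pos (hsub hz).2.1 _).ne'
  obtain ⟨⟨xs, ψs⟩, hmem, hmax⟩ := (isCompact_Icc.prod isCompact_Icc).exists_isMaxOn
    ⟨(xb, ψb), ⟨hxb, hηb.le, hψb.2⟩⟩ hΦ
  have hxs : xs ∈ Icc x0 X' := hmem.1
  have hψs : ψs ∈ Ioc 0 δ := (hsub hmem).2
  have hψs0 := hψs.1
  have hppos : ∀ ψ : ℝ, 0 < ψ → 0 < ψ ^ (1 - β) := fun ψ h => Real.rpow_pos_of_pos h _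
  have hbad' : A * ψs ^ (1 - β) < F xs ψs * (xs - x0) := by
    have h1 := hmax (show (xb, ψb) ∈ _ from ⟨hxb, hηb.le, hψb.2⟩)
    simp only [mem_ofPred_eq] at h1
    rw [← lt_div_iff₀ (hppos _ hψs0)]
    rw [← lt_div_iff₀ (hppos _ hψb.1)] at hbad
    linarith
  have hψη : η < ψs := by
    by_contra hh
    push Not at hh
    exact absurd (hsmall xs hxs ψs hψs hh) (not_le.2 hbad')
  set t := xs - x0 with htdef
  have ht0 : 0 < t := by
    rcases (sub_nonneg.2 hxs.1).lt_or_eq with h | h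
    · exact h
    · rw [htdef, ← h] at hbad'
      have := hppos _ hψs0
      nlinarith
  have hF0 : 0 < F xs ψs := by
    have h1 : 0 < F xs ψs * t := lt_trans (mul_pos hA0 (hppos _ hψs0)) hbad'
    exact pos_of_mul_pos_left h1 ht0.le
  have hle1 : ψs ≤ 1 := hψs.2.trans hδ
  have hbad2 : A * ψs < F xs ψs * t :=
    lt_of_le_of_lt (by gcongr; exact le_rpow_sub hψs0 hle1 hβ) hbad'
  set s := √ψs with hs
  have hs0 : 0 < s := Real.sqrt_pos.2 hψs0
  have hss : s * s = ψs := Real.mul_self_sqrt hψs0.le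
  have hFs : F xs ψs * s ≤ C := by
    have := hF1 xs hxs ψs hψs
    rwa [abs_of_pos hF0] at this
  have htL : t ≤ L := by linarith [hxs.2]
  -- ψs < ψ₁
  have hψlt : ψs < ψ₁ := by
    by_contra hh
    push Not at hh
    have h1 : √ψ₁ ≤ s := Real.sqrt_le_sqrt hh
    have h2 : F xs ψs * t * s ≤ C * L := by
      calc F xs ψs * t * s = (F xs ψs * s) * t := by ring
        _ ≤ C * L := by gcongr
    have h3 : A * (ψ₁ * √ψ₁) ≤ A * (ψs * s) := by gcongr
    have h4 : A * ψs * s < F xs ψs * t * s := by gcongr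
    linarith
  -- t > lam ψ^{3/2}
  have htl : lam * (ψs * s) < t := by
    by_contra hh
    push Not at hh
    have h1 : F xs ψs * t ≤ C * lam * ψs := by
      calc F xs ψs * t ≤ F xs ψs * (lam * (ψs * s)) := by gcongr
        _ = (F xs ψs * s) * (lam * ψs) := by ring
        _ ≤ C * (lam * ψs) := by gcongr
        _ = _ := by ring
    have h2 : C * lam * ψs ≤ A * ψs := by gcongr
    linarith
  have hψI : ψs ∈ Ioo 0 δ := ⟨hψs0, lt_of_lt_of_le hψlt hψ₁δ⟩
  -- derivative in x
  have hdx : 0 ≤ Fx xs ψs * t + F xs ψs := by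
    have hd : HasDerivAt (fun x => F x ψs * (x - x0)) (Fx xs ψs * (xs - x0) + F xs ψs * 1) xs :=
      (hFx xs hxs ψs hψI).mul ((hasDerivAt_id xs).sub_const x0)
    have := deriv_nonneg_of_left_max (a := x0) (by linarith) hd (by
      intro x hx
      have h1 := hmax (show (x, ψs) ∈ _ from ⟨⟨hx.1, hx.2.trans hxs.2⟩, hmem.2⟩)
      simp only [mem_ofPred_eq] at h1
      exact (div_le_div_iff_of_pos_right (hppos _ hψs0)).1 h1)
    simpa using this
  have hdy : deriv (deriv (F xs)) ψs * ψs ^ 2 ≤ -(β * (1 - β)) * F xs ψs := by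
    refine barrier_test hψs0 (hFy xs hxs ψs hψI) ?_
    filter_upwards [Ioo_mem_nhds hψη hψI.2] with y hy
    have h1 := hmax (show (xs, y) ∈ _ from ⟨hxs, hy.1.le, hy.2.le⟩)
    simp only [mem_ofPred_eq] at h1
    rw [div_le_div_iff₀ (hppos _ (hη0.trans hy.1)) (hppos _ hψs0)] at h1
    have h2 : t * (F xs y * ψs ^ (1 - β)) ≤ t * (F xs ψs * y ^ (1 - β)) := by
      calc _ = F xs y * (xs - x0) * ψs ^ (1 - β) := by ring
        _ ≤ _ := h1
        _ = _ := by ring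
    exact le_of_mul_le_mul_left h2 ht0
  have he := heq xs hxs ψs hψI
  have hu' := hu xs hxs ψs hψI
  have hc' := hc xs hxs ψs hψI
  have hg' := hg xs hxs ψs hψI
  rw [← hs] at hu' hg'
  set f := F xs ψs
  set D := deriv (deriv (F xs)) ψs
  have hβ2 : 0 < β * (1 - β) := mul_pos hβ (by linarith)
  -- u D ψ^2 ≤ -κ s f
  have k1 : u xs ψs * D * ψs ^ 2 ≤ - (κ * s * f) := by
    have hu0 : 0 ≤ u xs ψs := le_trans (by positivity) hu'
    calc u xs ψs * D * ψs ^ 2 = u xs ψs * (D * ψs ^ 2) := by ring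
      _ ≤ u xs ψs * (-(β * (1 - β)) * f) := by gcongr
      _ = - (u xs ψs * (β * (1 - β) * f)) := by ring
      _ ≤ - (μ * s * (β * (1 - β) * f)) := by
        apply neg_le_neg; gcongr
      _ = _ := by rw [hκ]; ring
  have k2 : c xs ψs * f ≤ K * f := by gcongr
  have k3 : g xs ψs * s ≤ C := le_trans (by gcongr; exact le_abs_self _) hg'
  -- multiply equation by ψ^2
  have k4 : Fx xs ψs * ψs ^ 2 ≤ -(κ * s * f) + K * f * ψs ^ 2 + g xs ψs * ψs ^ 2 := by
    rw [he]
    have : c xs ψs * f * ψs ^ 2 ≤ K * f * ψs ^ 2 := by gcongr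
    rw [add_mul, add_mul]
    linarith
  have k5 : g xs ψs * ψs ^ 2 ≤ C * (ψs * s) := by
    calc g xs ψs * ψs ^ 2 = (g xs ψs * s) * (ψs * s) := by rw [← hss]; ring
      _ ≤ _ := by gcongr
  have k6 : 4 * (C * (ψs * s)) ≤ κ * s * f := by
    have h1 : A * ψs < f * L := lt_of_lt_of_le hbad2 (by gcongr)
    have h2 : 4 * (C * L) * ψs ≤ κ * (f * L) := by
      calc 4 * (C * L) * ψs ≤ A * κ * ψs := by gcongr
        _ = κ * (A * ψs) := by ring
        _ ≤ _ := by gcongr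
    have h3 : (4 * C * ψs) * L ≤ (κ * f) * L := by linarith
    have h4 := le_of_mul_le_mul_right h3 hL0
    calc 4 * (C * (ψs * s)) = 4 * C * ψs * s := by ring
      _ ≤ κ * f * s := mul_le_mul_of_nonneg_right h4 hs0.le
      _ = _ := by ring
  have k7 : 4 * (K * f * ψs ^ 2) ≤ κ * s * f := by
    have h1 : K * (ψs * s) ≤ K * (ψ₁ * √ψ₁) := by
      have : s ≤ √ψ₁ := Real.sqrt_le_sqrt hψlt.le
      gcongr
    have h2 : 4 * (K * (ψs * s)) ≤ κ := by linarith
    calc 4 * (K * f * ψs ^ 2) = (4 * (K * (ψs * s))) * (s * f) := by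
          rw [← hss]; ring
      _ ≤ κ * (s * f) := by gcongr
      _ = _ := by ring
  -- time part
  have k8 : - (Fx xs ψs * ψs ^ 2) * 4 ≤ κ * s * f := by
    have h1 : - Fx xs ψs * t ≤ f := by linarith
    have h2 : (- Fx xs ψs) * t * (lam * (ψs * s)) ≤ f * t := by
      calc (- Fx xs ψs) * t * (lam * (ψs * s)) ≤ f * (lam * (ψs * s)) := by gcongr
        _ ≤ f * t := by gcongr
    have h3 : (- Fx xs ψs) * (lam * (ψs * s)) ≤ f := by
      refine le_of_mul_le_mul_right (a := t) ?_ ht0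
      linarith
    have h4 : (- Fx xs ψs) * (ψs * s) * 4 * lam ≤ (κ * f) * lam := by
      calc _ = 4 * ((- Fx xs ψs) * (lam * (ψs * s))) := by ring
        _ ≤ 4 * f := by gcongr
        _ ≤ lam * κ * f := by gcongr
        _ = _ := by ring
    have h5 := le_of_mul_le_mul_right h4 hlam0
    calc - (Fx xs ψs * ψs ^ 2) * 4 = ((- Fx xs ψs) * (ψs * s) * 4) * s := by
          rw [← hss]; ring
      _ ≤ κ * f * s := by gcongr
      _ = _ := by ring
  have k9 : 0 < κ * s * f := by positivity
  linarith

end OS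
namespace OS

lemma slice_x {X x ψ : ℝ} {h : ℝ → ℝ → ℝ}
    (hsm : ContDiffOn ℝ (⊤ : ℕ∞) (fun z : ℝ × ℝ => h z.1 z.2) (Ioo 0 X ×ˢ Ioi 0))
    (hx : x ∈ Ioo 0 X) (hψ : 0 < ψ) : ContDiffAt ℝ (⊤ : ℕ∞) (fun x => h x ψ) x := by
  have h1 : ContDiffAt ℝ (⊤ : ℕ∞) (fun z : ℝ × ℝ => h z.1 z.2) (x, ψ) :=
    hsm.contDiffAt ((isOpen_Ioo.prod isOpen_Ioi).mem_nhds ⟨hx, hψ⟩)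
  exact h1.comp x (f := fun x : ℝ => (x, ψ)) (contDiffAt_id.prodMk contDiffAt_const)

lemma slice_y {X x ψ : ℝ} {h : ℝ → ℝ → ℝ}
    (hsm : ContDiffOn ℝ (⊤ : ℕ∞) (fun z : ℝ × ℝ => h z.1 z.2) (Ioo 0 X ×ˢ Ioi 0))
    (hx : x ∈ Ioo 0 X) (hψ : 0 < ψ) : ContDiffAt ℝ (⊤ : ℕ∞) (h x) ψ := by
  have h1 : ContDiffAt ℝ (⊤ : ℕ∞) (fun z : ℝ × ℝ => h z.1 z.2) (x, ψ) :=
    hsm.contDiffAt ((isOpen_Ioo.prod isOpen_Ioi).mem_nhds ⟨hx, hψ⟩)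
  exact h1.comp ψ (f := fun y : ℝ => (x, y)) (contDiffAt_const.prodMk contDiffAt_id)

lemma contDiffAt_deriv {f : ℝ → ℝ} {x : ℝ} (hf : ContDiffAt ℝ (⊤ : ℕ∞) f x) :
    ContDiffAt ℝ (⊤ : ℕ∞) (deriv f) x := by
  have h3 : ContDiffAt ℝ (⊤ : ℕ∞) (fderiv ℝ f) x := hf.fderiv_right (m := (⊤ : ℕ∞)) (by simp)
  exact h3.clm_apply contDiffAt_const

lemma contDiffAt_iteratedDeriv {f : ℝ → ℝ} {x : ℝ} (n : ℕ) (hf : ContDiffAt ℝ (⊤ : ℕ∞) f x) :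
    ContDiffAt ℝ (⊤ : ℕ∞) (iteratedDeriv n f) x := by
  induction n with
  | zero => simpa using hf
  | succ n ih => rw [iteratedDeriv_succ]; exact contDiffAt_deriv ih

lemma lip_of_deriv {f : ℝ → ℝ} {a X B : ℝ} (hd : ∀ x ∈ Ico a X, DifferentiableAt ℝ f x)
    (hb : ∀ x ∈ Ico a X, |deriv f x| ≤ B) : ∀ x ∈ Ico a X, ∀ y ∈ Ico a X,
    |f x - f y| ≤ B * |x - y| := by
  intro x hx y hy
  exact Convex.norm_image_sub_le_of_norm_deriv_le hd hb (convex_Ico a X) hy hx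

lemma dd_quot {f g : ℝ → ℝ} {y s : ℝ} (hf : ContDiffAt ℝ (⊤ : ℕ∞) f y)
    (hg : ContDiffAt ℝ (⊤ : ℕ∞) g y) :
    deriv (deriv (fun η => (f η - g η) / s)) y = (deriv (deriv f) y - deriv (deriv g) y) / s := by
  have hf2 : ContDiffAt ℝ 1 f y := hf.of_le (by exact_mod_cast le_top)
  have hg2 : ContDiffAt ℝ 1 g y := hg.of_le (by exact_mod_cast le_top)
  have e1 : deriv (fun η => (f η - g η) / s) =ᶠ[𝓝 y] fun η => (deriv f η - deriv g η) / s := by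
    filter_upwards [hf2.eventually (by simp), hg2.eventually (by simp)] with z h1 h2
    exact (((h1.differentiableAt (by simp)).hasDerivAt.sub
      (h2.differentiableAt (by simp)).hasDerivAt).div_const s).deriv
  rw [e1.deriv_eq]
  exact ((((contDiffAt_deriv hf).differentiableAt (by simp)).hasDerivAt.sub
      ((contDiffAt_deriv hg).differentiableAt (by simp)).hasDerivAt).div_const s).deriv

set_option maxHeartbeats 1000000 in
lemma core2 {a x0 X δ β μ K C : ℝ} {h u c G : ℝ → ℝ → ℝ}
    (ha : 0 < a) (hax : a < x0) (hx0X : x0 < X) (hδ0 : 0 < δ) (hδ : δ ≤ 1)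
    (hβ : 0 < β) (hβ1 : β < 1) (hμ : 0 < μ) (hK : 0 ≤ K) (hC : 0 ≤ C)
    (hsm : ContDiffOn ℝ (⊤ : ℕ∞) (fun z : ℝ × ℝ => h z.1 z.2) (Ioo 0 X ×ˢ Ioi 0))
    (heq : ∀ x ∈ Ico a X, ∀ ψ ∈ Ioc 0 δ, deriv (fun x => h x ψ) x
      = u x ψ * deriv (deriv (h x)) ψ + c x ψ * h x ψ + G x ψ)
    (hu : ∀ x ∈ Ico a X, ∀ ψ ∈ Ioc 0 δ, μ * √ψ ≤ u x ψ)
    (hc : ∀ x ∈ Ico a X, ∀ ψ ∈ Ioc 0 δ, c x ψ ≤ K)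
    (hLu : ∀ ψ ∈ Ioc 0 δ, ∀ x ∈ Ico a X, ∀ y ∈ Ico a X, |u x ψ - u y ψ| ≤ C * √ψ * |x - y|)
    (hLc : ∀ ψ ∈ Ioc 0 δ, ∀ x ∈ Ico a X, ∀ y ∈ Ico a X,
      |c x ψ - c y ψ| * (ψ * √ψ) ≤ C * |x - y|)
    (hLG : ∀ ψ ∈ Ioc 0 δ, ∀ x ∈ Ico a X, ∀ y ∈ Ico a X, |G x ψ - G y ψ| * √ψ ≤ C * |x - y|)
    (hyy : ∀ x ∈ Ico a X, ∀ ψ ∈ Ioc 0 δ, |deriv (deriv (h x)) ψ| * ψ ≤ C)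
    (hh : ∀ x ∈ Ico a X, ∀ ψ ∈ Ioc 0 δ, |h x ψ| ≤ C * ψ)
    (hhx : ∀ x ∈ Ico a X, ∀ ψ ∈ Ioc 0 δ, |deriv (fun x => h x ψ) x| * √ψ ≤ C) :
    ∃ A > 0, ∀ x ∈ Ioo x0 X, ∀ ψ ∈ Ioc 0 δ,
      deriv (fun x => h x ψ) x * (x - x0) ≤ A * ψ ^ (1 - β) := by
  have hβ2 : 0 < β * (1 - β) := mul_pos hβ (by linarith)
  set κ := μ * (β * (1 - β)) with hκ
  have hκ0 : 0 < κ := by positivity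
  set L := X - x0 with hL
  have hL0 : 0 < L := by linarith
  set C' := C + C * C + C * C with hC'
  have hC'0 : 0 ≤ C' := by positivity
  have hCC' : C ≤ C' := by nlinarith
  set ψ₁ := min δ (κ / (4 * (K + 1))) with hψ₁
  have hψ₁0 : 0 < ψ₁ := lt_min hδ0 (by positivity)
  have hψ₁δ : ψ₁ ≤ δ := min_le_left _ _
  have hsq0 : 0 < √ψ₁ := Real.sqrt_pos.2 hψ₁0
  have hsq1 : √ψ₁ ≤ 1 := Real.sqrt_le_one.2 (hψ₁δ.trans hδ)
  have hKψ : 4 * (K * (ψ₁ * √ψ₁)) ≤ κ := by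
    have h1 : ψ₁ * (4 * (K + 1)) ≤ κ := by
      rw [← le_div_iff₀ (by positivity)]; exact min_le_right _ _
    have h2 : ψ₁ * √ψ₁ ≤ ψ₁ := by nlinarith
    have h3 : K * (ψ₁ * √ψ₁) ≤ K * ψ₁ := by gcongr
    linarith
  set lam := 4 / κ with hlam
  have hlam0 : 0 < lam := by positivity
  set A := C' * lam + 4 * (C' * L) / κ + C' * L / (ψ₁ * √ψ₁) + 1 with hA
  have t1 : 0 ≤ C' * lam := by positivity
  have t2 : 0 ≤ 4 * (C' * L) / κ := by positivity
  have t3 : 0 ≤ C' * L / (ψ₁ * √ψ₁) := by positivity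
  have hA0 : 0 < A := by linarith
  refine ⟨A, hA0, ?_⟩
  intro x hx ψ hψ
  have hIoo : ∀ y ∈ Ico a X, y ∈ Ioo 0 X := fun y hy => ⟨lt_of_lt_of_le ha hy.1, hy.2⟩
  -- finite difference estimate
  have key : ∀ s, 0 < s → s < x0 - a →
      (h x ψ - h (x - s) ψ) / s * (x - x0) ≤ A * ψ ^ (1 - β) := by
    intro s hs hsa
    have m1 : ∀ y ∈ Icc x0 x, y ∈ Ico a X := fun y hy =>
      ⟨by linarith [hy.1], lt_of_le_of_lt hy.2 hx.2⟩
    have m2 : ∀ y ∈ Icc x0 x, y - s ∈ Ico a X := fun y hy =>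
      ⟨by linarith [hy.1], by linarith [hy.2, hx.2]⟩
    have hab : ∀ y, |y - (y - s)| = s := fun y => by
      rw [sub_sub_cancel, abs_of_pos hs]
    refine core_F (x0 := x0) (X' := x) (δ := δ) (β := β) (μ := μ) (K := K) (C := C') (L := L)
      (lam := lam) (ψ₁ := ψ₁) (A := A)
      (F := fun y η => (h y η - h (y - s) η) / s) (u := u) (c := c)
      (g := fun y η => ((G y η - G (y - s) η) + deriv (deriv (h (y - s))) η * (u y η - u (y - s) η)
        + h (y - s) η * (c y η - c (y - s) η)) / s)
      (Fx := fun y η => (deriv (fun x => h x η) y - deriv (fun x => h x η) (y - s)) / s)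
      hδ hβ hβ1 hμ hK hC'0 (by linarith [hx.2]) hL0 hψ₁0 hψ₁δ hlam0 ?_ hKψ hA0 (by linarith)
      ?_ ?_ ?_ ?_ ?_ ?_ ?_ ?_ ?_ ?_ ?_ x ⟨hx.1.le, le_rfl⟩ ψ hψ
    · rw [← hκ, hlam]; field_simp; exact le_rfl
    · rw [← hκ, ← div_le_iff₀ hκ0]; linarith
    · rw [← div_le_iff₀ (by positivity)]; linarith
    · have hc1 : ContinuousOn (fun z : ℝ × ℝ => h z.1 z.2) (Ioo 0 X ×ˢ Ioi 0) := hsm.continuousOn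
      have hc2 : ContinuousOn (fun z : ℝ × ℝ => h z.1 z.2) (Icc x0 x ×ˢ Ioc 0 δ) :=
        hc1.mono fun z hz => ⟨hIoo _ (m1 _ hz.1), hz.2.1⟩
      have hc3 : ContinuousOn (fun z : ℝ × ℝ => h (z.1 - s) z.2) (Icc x0 x ×ˢ Ioc 0 δ) :=
        hc1.comp (f := fun z : ℝ × ℝ => (z.1 - s, z.2)) (by fun_prop)
          fun z hz => ⟨hIoo _ (m2 _ hz.1), hz.2.1⟩
      exact (hc2.sub hc3).div_const s
    · intro y hy η hη
      have d1 := ((slice_x hsm (hIoo _ (m1 y hy)) hη.1).differentiableAt (by simp)).hasDerivAt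
      have d2 := ((slice_x hsm (hIoo _ (m2 y hy)) hη.1).differentiableAt (by simp)).hasDerivAt
      exact (d1.sub (d2.comp_sub_const y s)).div_const s
    · intro y hy η hη
      have d1 : ContDiffAt ℝ 2 (h y) η :=
        contDiffAt_infty.1 (slice_y hsm (hIoo _ (m1 y hy)) hη.1) 2
      have d2 : ContDiffAt ℝ 2 (h (y - s)) η :=
        contDiffAt_infty.1 (slice_y hsm (hIoo _ (m2 y hy)) hη.1) 2
      exact (d1.sub d2).div_const s
    · intro y hy η hη
      have hη' : η ∈ Ioc 0 δ := ⟨hη.1, hη.2.le⟩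
      rw [dd_quot (slice_y hsm (hIoo _ (m1 y hy)) hη.1) (slice_y hsm (hIoo _ (m2 y hy)) hη.1),
        heq y (m1 y hy) η hη', heq (y - s) (m2 y hy) η hη']
      ring
    · intro y hy η hη
      exact hu y (m1 y hy) η ⟨hη.1, hη.2.le⟩
    · intro y hy η hη
      exact hc y (m1 y hy) η ⟨hη.1, hη.2.le⟩
    · intro y hy η hη
      have hη' : η ∈ Ioc 0 δ := ⟨hη.1, hη.2.le⟩
      have e1 := hLG η hη' y (m1 y hy) (y - s) (m2 y hy)
      have e2 := hLu η hη' y (m1 y hy) (y - s) (m2 y hy)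
      have e3 := hLc η hη' y (m1 y hy) (y - s) (m2 y hy)
      have e4 := hyy (y - s) (m2 y hy) η hη'
      have e5 := hh (y - s) (m2 y hy) η hη'
      rw [hab] at e1 e2 e3
      have hq0 : 0 < √η := Real.sqrt_pos.2 hη.1
      have hqq : √η * √η = η := Real.mul_self_sqrt hη.1.le
      rw [abs_div, abs_of_pos hs, div_mul_eq_mul_div, div_le_iff₀ hs]
      have f1 : |deriv (deriv (h (y - s))) η * (u y η - u (y - s) η)| * √η ≤ C * C * s := by
        rw [abs_mul]
        calc |deriv (deriv (h (y - s))) η| * |u y η - u (y - s) η| * √η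
            ≤ |deriv (deriv (h (y - s))) η| * (C * √η * s) * √η := by gcongr
          _ = (|deriv (deriv (h (y - s))) η| * (√η * √η)) * (C * s) := by ring
          _ ≤ C * (C * s) := by rw [hqq]; gcongr
          _ = _ := by ring
      have f2 : |h (y - s) η * (c y η - c (y - s) η)| * √η ≤ C * C * s := by
        rw [abs_mul]
        calc |h (y - s) η| * |c y η - c (y - s) η| * √η
            ≤ (C * η) * |c y η - c (y - s) η| * √η := by gcongr
          _ = C * (|c y η - c (y - s) η| * (η * √η)) := by ring
          _ ≤ C * (C * s) := by gcongr
          _ = _ := by ring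
      calc _ ≤ (|G y η - G (y - s) η| + |deriv (deriv (h (y - s))) η * (u y η - u (y - s) η)|
            + |h (y - s) η * (c y η - c (y - s) η)|) * √η := by
            gcongr
            exact abs_add_three _ _ _
        _ ≤ C * s + C * C * s + C * C * s := by rw [add_mul, add_mul]; gcongr
        _ = _ := by rw [hC']; ring
    · intro y hy η hη
      have hq0 : 0 < √η := Real.sqrt_pos.2 hη.1
      have := lip_of_deriv (f := fun x => h x η) (a := a) (X := X) (B := C / √η)
        (fun z hz => (slice_x hsm (hIoo z hz) hη.1).differentiableAt (by simp))
        (fun z hz => by rw [le_div_iff₀ hq0]; exact hhx z hz η hη) y (m1 y hy) (y - s) (m2 y hy)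
      rw [hab] at this
      rw [abs_div, abs_of_pos hs, div_mul_eq_mul_div, div_le_iff₀ hs]
      calc _ ≤ (C / √η * s) * √η := by gcongr
        _ = C * s := by field_simp
        _ ≤ _ := by gcongr
    · refine ⟨2 * C / s, fun y hy η hη => ?_⟩
      have e1 := hh y (m1 y hy) η hη
      have e2 := hh (y - s) (m2 y hy) η hη
      rw [abs_div, abs_of_pos hs, div_mul_eq_mul_div, div_le_div_iff_of_pos_right hs]
      calc _ ≤ |h y η| + |h (y - s) η| := abs_sub _ _
        _ ≤ _ := by linarith
  -- limit
  have hxX : x ∈ Ioo 0 X := ⟨by linarith [hx.1], hx.2⟩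
  have hd := ((slice_x hsm hxX hψ.1).differentiableAt (by simp)).hasDerivAt
  have ht := ((hasDerivAt_iff_tendsto_slope.1 hd).mono_left
    (nhdsWithin_mono x (show Iio x ⊆ {x}ᶜ from fun y hy => ne_of_lt hy))).mul_const (x - x0)
  refine le_of_tendsto ht ?_
  filter_upwards [Ioo_mem_nhdsLT (show x - (x0 - a) < x by linarith)] with y hy
  have := key (x - y) (by linarith [hy.2]) (by linarith [hy.1])
  rw [sub_sub_cancel] at this
  rw [slope_comm, slope_def_field]
  exact this

end OS
namespace OS

/-- Size and Lipschitz (in `x`) control with weight `ψ ^ r`. -/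
def LipB (a X δ r : ℝ) (F : ℝ → ℝ → ℝ) : Prop :=
  ∃ C ≥ 0, ∀ ψ ∈ Ioc 0 δ, ∀ x ∈ Ico a X, |F x ψ| ≤ C * ψ ^ r ∧
    ∀ y ∈ Ico a X, |F x ψ - F y ψ| ≤ C * ψ ^ r * |x - y|

section
variable {a X δ r s : ℝ} {F G : ℝ → ℝ → ℝ}

lemma LipB.mul (hF : LipB a X δ r F) (hG : LipB a X δ s G) :
    LipB a X δ (r + s) (fun x ψ => F x ψ * G x ψ) := by
  obtain ⟨C, hC, h1⟩ := hF
  obtain ⟨D, hD, h2⟩ := hG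
  refine ⟨2 * (C * D), by positivity, fun ψ hψ x hx => ?_⟩
  rw [Real.rpow_add hψ.1]
  have p1 : 0 < ψ ^ r := Real.rpow_pos_of_pos hψ.1 _
  have p2 : 0 < ψ ^ s := Real.rpow_pos_of_pos hψ.1 _
  have hx1 := (h1 ψ hψ x hx).1
  have hx2 := (h2 ψ hψ x hx).1
  constructor
  · rw [abs_mul]
    calc |F x ψ| * |G x ψ| ≤ (C * ψ ^ r) * (D * ψ ^ s) := by gcongr
      _ = C * D * (ψ ^ r * ψ ^ s) := by ring
      _ ≤ 2 * (C * D) * (ψ ^ r * ψ ^ s) :=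
        mul_le_mul_of_nonneg_right (by linarith [mul_nonneg hC hD]) (by positivity)
  · intro y hy
    have hy1 := (h1 ψ hψ x hx).2 y hy
    have hy2 := (h2 ψ hψ x hx).2 y hy
    have hy3 := (h2 ψ hψ y hy).1
    have : F x ψ * G x ψ - F y ψ * G y ψ = F x ψ * (G x ψ - G y ψ) + (F x ψ - F y ψ) * G y ψ := by
      ring
    rw [this]
    calc _ ≤ |F x ψ| * |G x ψ - G y ψ| + |F x ψ - F y ψ| * |G y ψ| := by
          rw [← abs_mul, ← abs_mul]; exact abs_add_le _ _
      _ ≤ (C * ψ ^ r) * (D * ψ ^ s * |x - y|) + (C * ψ ^ r * |x - y|) * (D * ψ ^ s) := by gcongr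
      _ = _ := by ring

lemma LipB.add (hF : LipB a X δ r F) (hG : LipB a X δ r G) :
    LipB a X δ r (fun x ψ => F x ψ + G x ψ) := by
  obtain ⟨C, hC, h1⟩ := hF
  obtain ⟨D, hD, h2⟩ := hG
  refine ⟨C + D, by positivity, fun ψ hψ x hx => ⟨?_, fun y hy => ?_⟩⟩
  · have hx1 := (h1 ψ hψ x hx).1
    have hx2 := (h2 ψ hψ x hx).1
    linarith [abs_add_le (F x ψ) (G x ψ)]
  · have hx1 := (h1 ψ hψ x hx).2 y hy
    have hx2 := (h2 ψ hψ x hx).2 y hy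
    have : F x ψ + G x ψ - (F y ψ + G y ψ) = (F x ψ - F y ψ) + (G x ψ - G y ψ) := by ring
    rw [this]
    linarith [abs_add_le (F x ψ - F y ψ) (G x ψ - G y ψ)]

lemma LipB.const_mul (k : ℝ) (hF : LipB a X δ r F) : LipB a X δ r (fun x ψ => k * F x ψ) := by
  obtain ⟨C, hC, h1⟩ := hF
  refine ⟨|k| * C, by positivity, fun ψ hψ x hx => ⟨?_, fun y hy => ?_⟩⟩
  · rw [abs_mul, mul_assoc]
    have := (h1 ψ hψ x hx).1
    gcongr
  · rw [← mul_sub, abs_mul, mul_assoc, mul_assoc, ← mul_assoc C]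
    have := (h1 ψ hψ x hx).2 y hy
    gcongr

lemma LipB.sum {ι : Type*} (T : Finset ι) {F : ι → ℝ → ℝ → ℝ} (h : ∀ i ∈ T, LipB a X δ r (F i)) :
    LipB a X δ r (fun x ψ => ∑ i ∈ T, F i x ψ) := by
  classical
  induction T using Finset.induction_on with
  | empty => exact ⟨0, le_rfl, fun ψ hψ x hx => by simp⟩
  | insert i T hi ih =>
    have h1 := (h i (Finset.mem_insert_self _ _)).add
      (ih fun j hj => h j (Finset.mem_insert_of_mem hj))
    simpa [Finset.sum_insert hi] using h1

lemma LipB.mono (hδ : δ ≤ 1) (hrs : s ≤ r) (hF : LipB a X δ r F) : LipB a X δ s F := by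
  obtain ⟨C, hC, h1⟩ := hF
  refine ⟨C, hC, fun ψ hψ x hx => ?_⟩
  have hp : ψ ^ r ≤ ψ ^ s := Real.rpow_le_rpow_of_exponent_ge hψ.1 (hψ.2.trans hδ) hrs
  refine ⟨(h1 ψ hψ x hx).1.trans (by gcongr), fun y hy => ((h1 ψ hψ x hx).2 y hy).trans ?_⟩
  gcongr

lemma LipB.inv {μ : ℝ} (hμ : 0 < μ) (hF : LipB a X δ r F)
    (hlow : ∀ ψ ∈ Ioc 0 δ, ∀ x ∈ Ico a X, μ * ψ ^ r ≤ F x ψ) :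
    LipB a X δ (-r) (fun x ψ => (F x ψ)⁻¹) := by
  obtain ⟨C, hC, h1⟩ := hF
  refine ⟨1 / μ + C / μ ^ 2, by positivity, fun ψ hψ x hx => ?_⟩
  have p1 : 0 < ψ ^ r := Real.rpow_pos_of_pos hψ.1 _
  have p2 : 0 < μ * ψ ^ r := by positivity
  have hx0 := hlow ψ hψ x hx
  have hxp : 0 < F x ψ := lt_of_lt_of_le p2 hx0
  rw [Real.rpow_neg hψ.1.le]
  have q1 : 0 ≤ C / μ ^ 2 * (ψ ^ r)⁻¹ := by positivity
  have q2 : 0 ≤ 1 / μ * (ψ ^ r)⁻¹ := by positivity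
  refine ⟨?_, fun y hy => ?_⟩
  · rw [abs_of_pos (by positivity)]
    calc (F x ψ)⁻¹ ≤ (μ * ψ ^ r)⁻¹ := by gcongr
      _ = 1 / μ * (ψ ^ r)⁻¹ := by rw [mul_inv]; ring
      _ ≤ _ := by rw [add_mul]; linarith
  · have hy0 := hlow ψ hψ y hy
    have hyp : 0 < F y ψ := lt_of_lt_of_le p2 hy0
    have e : (F x ψ)⁻¹ - (F y ψ)⁻¹ = - (F x ψ - F y ψ) * ((F x ψ)⁻¹ * (F y ψ)⁻¹) := by
      field_simp; ring
    rw [e, abs_mul, abs_neg, abs_of_pos (show 0 < (F x ψ)⁻¹ * (F y ψ)⁻¹ by positivity)]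
    calc |F x ψ - F y ψ| * ((F x ψ)⁻¹ * (F y ψ)⁻¹)
        ≤ (C * ψ ^ r * |x - y|) * ((μ * ψ ^ r)⁻¹ * (μ * ψ ^ r)⁻¹) := by
          have := (h1 ψ hψ x hx).2 y hy
          gcongr
      _ = C / μ ^ 2 * (ψ ^ r)⁻¹ * |x - y| := by field_simp
      _ ≤ _ := by
        gcongr
        have : 0 ≤ 1 / μ := by positivity
        linarith

lemma LipB.of_deriv {C : ℝ} (hC : 0 ≤ C)
    (hd : ∀ ψ ∈ Ioc 0 δ, ∀ x ∈ Ico a X, DifferentiableAt ℝ (fun x => F x ψ) x)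
    (h0 : ∀ ψ ∈ Ioc 0 δ, ∀ x ∈ Ico a X, |F x ψ| ≤ C * ψ ^ r)
    (h1 : ∀ ψ ∈ Ioc 0 δ, ∀ x ∈ Ico a X, |deriv (fun x => F x ψ) x| ≤ C * ψ ^ r) :
    LipB a X δ r F :=
  ⟨C, hC, fun ψ hψ x hx => ⟨h0 ψ hψ x hx, fun y hy =>
    lip_of_deriv (hd ψ hψ) (h1 ψ hψ) x hx y hy⟩⟩

end

/-- Leibniz with the extreme terms split off. -/
lemma leibniz {f g : ℝ → ℝ} {x : ℝ} (l : ℕ) (hf : ContDiffAt ℝ (⊤ : ℕ∞) f x)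
    (hg : ContDiffAt ℝ (⊤ : ℕ∞) g x) :
    iteratedDeriv (l + 1) (fun x => f x * g x) x = f x * iteratedDeriv (l + 1) g x
      + iteratedDeriv (l + 1) f x * g x + ∑ i ∈ Finset.range l,
        ((l + 1).choose (i + 1) : ℝ) * (iteratedDeriv (i + 1) f x * iteratedDeriv (l - i) g x) := by
  rw [iteratedDeriv_fun_mul (contDiffAt_infty.1 hf (l + 1)) (contDiffAt_infty.1 hg (l + 1)),
    Finset.sum_range_succ, Finset.sum_range_succ']
  have : ∀ i, l + 1 - (i + 1) = l - i := fun i => by omega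
  simp only [this, mul_assoc]
  simp
  ring

/-- Partial derivative in the first variable. -/
noncomputable def dX (W : ℝ × ℝ → ℝ) (z : ℝ × ℝ) : ℝ := deriv (fun x => W (x, z.2)) z.1

/-- Partial derivative in the second variable. -/
noncomputable def dY (W : ℝ × ℝ → ℝ) (z : ℝ × ℝ) : ℝ := deriv (fun y => W (z.1, y)) z.2

lemma dX_eq {W : ℝ × ℝ → ℝ} {z : ℝ × ℝ} (h : DifferentiableAt ℝ W z) :
    dX W z = fderiv ℝ W z (1, 0) := by
  have h1 : HasDerivAt (fun x : ℝ => (x, z.2)) ((1 : ℝ), (0 : ℝ)) z.1 :=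
    (hasDerivAt_id z.1).prodMk (hasDerivAt_const z.1 z.2)
  exact (h.hasFDerivAt.comp_hasDerivAt z.1 (f := fun x : ℝ => (x, z.2)) h1).deriv

lemma dY_eq {W : ℝ × ℝ → ℝ} {z : ℝ × ℝ} (h : DifferentiableAt ℝ W z) :
    dY W z = fderiv ℝ W z (0, 1) := by
  have h1 : HasDerivAt (fun y : ℝ => (z.1, y)) ((0 : ℝ), (1 : ℝ)) z.2 :=
    (hasDerivAt_const z.2 z.1).prodMk (hasDerivAt_id z.2)
  exact (h.hasFDerivAt.comp_hasDerivAt z.2 (f := fun y : ℝ => (z.1, y)) h1).deriv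

section
variable {W W' : ℝ × ℝ → ℝ} {U : Set (ℝ × ℝ)}

lemma diffAt_of (hU : IsOpen U) (h : ContDiffOn ℝ (⊤ : ℕ∞) W U) {z : ℝ × ℝ} (hz : z ∈ U) :
    DifferentiableAt ℝ W z :=
  (h.contDiffAt (hU.mem_nhds hz)).differentiableAt (by simp)

lemma smooth_dX (hU : IsOpen U) (h : ContDiffOn ℝ (⊤ : ℕ∞) W U) :
    ContDiffOn ℝ (⊤ : ℕ∞) (dX W) U := by
  have h1 : ContDiffOn ℝ (⊤ : ℕ∞) (fderiv ℝ W) U := h.fderiv_of_isOpen hU (by simp)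
  exact (h1.clm_apply contDiffOn_const).congr fun z hz => dX_eq (diffAt_of hU h hz)

lemma smooth_dY (hU : IsOpen U) (h : ContDiffOn ℝ (⊤ : ℕ∞) W U) :
    ContDiffOn ℝ (⊤ : ℕ∞) (dY W) U := by
  have h1 : ContDiffOn ℝ (⊤ : ℕ∞) (fderiv ℝ W) U := h.fderiv_of_isOpen hU (by simp)
  exact (h1.clm_apply contDiffOn_const).congr fun z hz => dY_eq (diffAt_of hU h hz)

lemma congr_dX (hU : IsOpen U) (h : EqOn W W' U) : EqOn (dX W) (dX W') U := by
  intro z hz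
  apply Filter.EventuallyEq.deriv_eq
  have : ∀ᶠ x in 𝓝 z.1, (x, z.2) ∈ U :=
    (Continuous.tendsto (by fun_prop : Continuous fun x : ℝ => (x, z.2)) z.1) (hU.mem_nhds hz)
  filter_upwards [this] with x hx using h hx

lemma congr_dY (hU : IsOpen U) (h : EqOn W W' U) : EqOn (dY W) (dY W') U := by
  intro z hz
  apply Filter.EventuallyEq.deriv_eq
  have : ∀ᶠ y in 𝓝 z.2, (z.1, y) ∈ U :=
    (Continuous.tendsto (by fun_prop : Continuous fun y : ℝ => (z.1, y)) z.2) (hU.mem_nhds hz)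
  filter_upwards [this] with x hx using h hx

lemma comm_dXY (hU : IsOpen U) (h : ContDiffOn ℝ (⊤ : ℕ∞) W U) :
    EqOn (dY (dX W)) (dX (dY W)) U := by
  intro z hz
  have h1 : ContDiffOn ℝ (⊤ : ℕ∞) (fderiv ℝ W) U := h.fderiv_of_isOpen hU (by simp)
  have hd : DifferentiableAt ℝ (fderiv ℝ W) z :=
    (h1.contDiffAt (hU.mem_nhds hz)).differentiableAt (by simp)
  have hsym : IsSymmSndFDerivAt ℝ W z :=
    (h.contDiffAt (hU.mem_nhds hz)).isSymmSndFDerivAt (by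
      rw [minSmoothness_of_isRCLikeNormedField]
      exact WithTop.coe_le_coe.2 (le_top : (2 : ℕ∞) ≤ ⊤))
  have aux : ∀ v v' : ℝ × ℝ, fderiv ℝ (fun z => fderiv ℝ W z v) z v'
      = fderiv ℝ (fderiv ℝ W) z v' v := by
    intro v v'
    rw [fderiv_clm_apply hd (differentiableAt_const v)]
    simp
  rw [congr_dY hU (fun z hz => dX_eq (diffAt_of hU h hz)) hz,
    congr_dX hU (fun z hz => dY_eq (diffAt_of hU h hz)) hz,
    dY_eq (hd.clm_apply (differentiableAt_const _)),
    dX_eq (hd.clm_apply (differentiableAt_const _)), aux, aux]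
  exact hsym _ _

lemma smooth_iter (hU : IsOpen U) (h : ContDiffOn ℝ (⊤ : ℕ∞) W U) (j : ℕ) :
    ContDiffOn ℝ (⊤ : ℕ∞) (dX^[j] W) U := by
  induction j with
  | zero => exact h
  | succ j ih => rw [Function.iterate_succ_apply']; exact smooth_dX hU ih

lemma comm_iter (hU : IsOpen U) (h : ContDiffOn ℝ (⊤ : ℕ∞) W U) (j : ℕ) :
    EqOn (dY (dX^[j] W)) (dX^[j] (dY W)) U := by
  induction j with
  | zero => intro z _; rfl
  | succ j ih =>
    intro z hz
    rw [Function.iterate_succ_apply', Function.iterate_succ_apply',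
      comm_dXY hU (smooth_iter hU h j) hz]
    exact congr_dX hU ih hz

end

lemma iter_eq (V : ℝ × ℝ → ℝ) (j : ℕ) (x ψ : ℝ) :
    iteratedDeriv j (fun x' => V (x', ψ)) x = (dX^[j] V) (x, ψ) := by
  induction j generalizing x with
  | zero => simp
  | succ j ih =>
    rw [iteratedDeriv_succ, Function.iterate_succ_apply', dX]
    congr 1
    funext y
    exact ih y

lemma pd0_eq (w : ℝ → ℝ → ℝ) (j : ℕ) (x ψ : ℝ) :
    pd j 0 w x ψ = (dX^[j] (fun z => w z.1 z.2)) (x, ψ) := by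
  rw [← iter_eq]; simp [pd]

lemma pd2_eq (w : ℝ → ℝ → ℝ) (j : ℕ) (x ψ : ℝ) :
    pd j 2 w x ψ = (dX^[j] (dY (dY (fun z => w z.1 z.2)))) (x, ψ) := by
  rw [← iter_eq]
  simp only [pd]
  congr 1
  funext y
  rw [iteratedDeriv_succ, iteratedDeriv_one]
  rfl

lemma endpoint {φ : ℝ → ℝ} {b X L : ℝ} (n : ℕ) (hbX : b < X)
    (hs : ∀ x ∈ Ico b X, ContDiffAt ℝ (⊤ : ℕ∞) φ x)
    (hL : ∀ x ∈ Ico b X, |iteratedDeriv (n + 1) φ x| ≤ L) : |iteratedDeriv (n + 1) φ X| ≤ L := by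
  have hL0 : 0 ≤ L := le_trans (abs_nonneg _) (hL b ⟨le_rfl, hbX⟩)
  rw [iteratedDeriv_succ] at hL ⊢
  set g := iteratedDeriv n φ
  by_cases hd : DifferentiableAt ℝ g X
  · have ht := ((hasDerivAt_iff_tendsto_slope.1 hd.hasDerivAt).mono_left
      (nhdsWithin_mono X (show Iio X ⊆ {X}ᶜ from fun y hy => ne_of_lt hy))).abs
    refine le_of_tendsto ht ?_
    filter_upwards [Ioo_mem_nhdsLT hbX] with x hx
    have hg : ∀ y ∈ Ico b X, DifferentiableAt ℝ g y := fun y hy =>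
      (contDiffAt_iteratedDeriv n (hs y hy)).differentiableAt (by simp)
    obtain ⟨ξ, hξ, he⟩ := exists_deriv_eq_slope g hx.2 (by
      intro y hy
      rcases hy.2.lt_or_eq with h | h
      · exact (hg y ⟨hx.1.le.trans hy.1, h⟩).continuousAt.continuousWithinAt
      · rw [h]; exact hd.continuousAt.continuousWithinAt) (by
      intro y hy
      exact (hg y ⟨hx.1.le.trans hy.1.le, hy.2⟩).differentiableWithinAt)
    rw [slope_comm, slope_def_field, ← he]
    exact hL ξ ⟨hx.1.le.trans hξ.1.le, hξ.2⟩
  · rw [deriv_zero_of_not_differentiableAt hd]; simpa using hL0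

end OS
namespace OS

lemma rpow_neg_half {ψ : ℝ} (h : 0 < ψ) : ψ ^ (-(1 : ℝ) / 2) * √ψ = 1 := by
  rw [Real.sqrt_eq_rpow, ← Real.rpow_add h]; norm_num

set_option maxHeartbeats 1000000 in
lemma interior {X : ℝ} {p : ℝ → ℝ} {w : ℝ → ℝ → ℝ} {α m M C₀ δ₁ : ℝ}
    (hw : OleinikSolution X p w α m M C₀ δ₁)
    {ε : ℝ} (hε : 0 < ε) (hεX : ε < X) {l : ℕ}
    {δ₃ : ℝ} (hδ₃ : δ₃ ∈ Set.Ioo (0 : ℝ) 1) (hδ₃δ₁ : δ₃ ≤ δ₁)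
    {C₁ : ℝ} (hC₁ : 0 < C₁)
    (hIH : IH (l + 2) w (Set.Icc (ε / 2) X ×ˢ Set.Ioc (0 : ℝ) δ₃) C₁)
    {β : ℝ} (hβ : 0 < β) (hβ1 : β < 1) :
    ∃ M₁ > 0, ∀ x ∈ Ico (7 * ε / 8) X, ∀ ψ ∈ Ioc (0 : ℝ) δ₃,
          |pd (l + 2) 0 w x ψ| ≤ M₁ * ψ ^ ((1 : ℝ) - β) ∧
          |pd (l + 2) 0 (fun x' ψ' => Real.sqrt (w x' ψ')) x ψ|
            ≤ M₁ * ψ ^ ((1 : ℝ) / 2 - β) := by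
  set a := ε / 2 with ha
  have ha0 : 0 < a := by positivity
  have hδ0 := hδ₃.1
  have hδ1 : δ₃ ≤ 1 := hδ₃.2.le
  have hU : IsOpen (Ioo (0 : ℝ) X ×ˢ Ioi (0 : ℝ)) := isOpen_Ioo.prod isOpen_Ioi
  have hW : ContDiffOn ℝ (⊤ : ℕ∞) (fun z : ℝ × ℝ => w z.1 z.2) (Ioo 0 X ×ˢ Ioi 0) :=
    hw.smooth.mono (prod_mono Ioo_subset_Ioc_self le_rfl)
  have hIoo : ∀ y ∈ Ico a X, y ∈ Ioo 0 X := fun y hy => ⟨lt_of_lt_of_le ha0 hy.1, hy.2⟩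
  have hm := hw.hm
  have hsm : 0 < √m := Real.sqrt_pos.2 hm
  -- facts about w
  have hwlow : ∀ x ∈ Ioo 0 X, ∀ ψ ∈ Ioc 0 δ₃, m * ψ < w x ψ := fun x hx ψ hψ =>
    hw.growth_lb x ⟨hx.1.le, hx.2.le⟩ ψ ⟨hψ.1, hψ.2.trans hδ₃δ₁⟩
  have hwpos : ∀ x ∈ Ioo 0 X, ∀ ψ ∈ Ioc 0 δ₃, 0 < w x ψ := fun x hx ψ hψ =>
    lt_trans (mul_pos hm hψ.1) (hwlow x hx ψ hψ)
  have hwx : ∀ x ∈ Ioo 0 X, ∀ ψ ∈ Ioc 0 δ₃, ContDiffAt ℝ (⊤ : ℕ∞) (fun x => w x ψ) x :=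
    fun x hx ψ hψ => slice_x hW hx hψ.1
  set u : ℝ → ℝ → ℝ := fun x ψ => √(w x ψ) with hu
  have hux : ∀ x ∈ Ioo 0 X, ∀ ψ ∈ Ioc 0 δ₃, ContDiffAt ℝ (⊤ : ℕ∞) (fun x => u x ψ) x :=
    fun x hx ψ hψ => (hwx x hx ψ hψ).sqrt (hwpos x hx ψ hψ).ne'
  have hupos : ∀ x ∈ Ioo 0 X, ∀ ψ ∈ Ioc 0 δ₃, 0 < u x ψ := fun x hx ψ hψ =>
    Real.sqrt_pos.2 (hwpos x hx ψ hψ)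
  have huu : ∀ x ∈ Ioo 0 X, ∀ ψ ∈ Ioc 0 δ₃, u x ψ * u x ψ = w x ψ := fun x hx ψ hψ =>
    Real.mul_self_sqrt (hwpos x hx ψ hψ).le
  have hulow : ∀ x ∈ Ico a X, ∀ ψ ∈ Ioc 0 δ₃, √m * √ψ ≤ u x ψ := fun x hx ψ hψ => by
    rw [← Real.sqrt_mul hm.le]
    exact Real.sqrt_le_sqrt (hwlow x (hIoo x hx) ψ hψ).le
  set v : ℝ → ℝ → ℝ := fun x ψ => iteratedDeriv 2 (w x) ψ with hv
  have hvW : ∀ x ψ, v x ψ = dY (dY (fun z : ℝ × ℝ => w z.1 z.2)) (x, ψ) := by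
    intro x ψ
    simpa [pd] using pd2_eq w 0 x ψ
  have hvsm : ContDiffOn ℝ (⊤ : ℕ∞) (fun z : ℝ × ℝ => v z.1 z.2) (Ioo 0 X ×ˢ Ioi 0) :=
    (smooth_dY hU (smooth_dY hU hW)).congr fun z _ => hvW z.1 z.2
  have hvx : ∀ x ∈ Ioo 0 X, ∀ ψ ∈ Ioc 0 δ₃, ContDiffAt ℝ (⊤ : ℕ∞) (fun x => v x ψ) x :=
    fun x hx ψ hψ => slice_x hvsm hx hψ.1
  -- notation for x-derivatives
  set U : ℕ → ℝ → ℝ → ℝ := fun j x ψ => iteratedDeriv j (fun x => u x ψ) x with hUdef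
  set V : ℕ → ℝ → ℝ → ℝ := fun j x ψ => iteratedDeriv j (fun x => v x ψ) x with hVdef
  have hmem : ∀ x ∈ Ico a X, ∀ ψ ∈ Ioc 0 δ₃,
      (x, ψ) ∈ Set.Icc a X ×ˢ Set.Ioc (0 : ℝ) δ₃ := fun x hx ψ hψ => ⟨⟨hx.1, hx.2.le⟩, hψ⟩
  have bU : ∀ j ≤ l + 1, ∀ ψ ∈ Ioc 0 δ₃, ∀ x ∈ Ico a X, |U j x ψ| ≤ C₁ * ψ ^ ((1 : ℝ) / 2) := by
    intro j hj ψ hψ x hx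
    have := ((hIH (x, ψ) (hmem x hx ψ hψ)).1 j (by omega)).2.2.2
    simpa [pd] using this
  have bV : ∀ j ≤ l + 1, ∀ ψ ∈ Ioc 0 δ₃, ∀ x ∈ Ico a X, |V j x ψ| ≤ C₁ * ψ ^ (-1 : ℝ) := by
    intro j hj ψ hψ x hx
    have := ((hIH (x, ψ) (hmem x hx ψ hψ)).1 j (by omega)).2.1
    rw [Real.rpow_neg_one]
    simpa [pd] using this
  have LU : ∀ j ≤ l, LipB a X δ₃ ((1 : ℝ) / 2) (U j) := by
    intro j hj
    refine LipB.of_deriv hC₁.le (fun ψ hψ x hx => ?_) (bU j (by omega)) (fun ψ hψ x hx => ?_)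
    · exact (contDiffAt_iteratedDeriv j (hux x (hIoo x hx) ψ hψ)).differentiableAt (by simp)
    · have := bU (j + 1) (by omega) ψ hψ x hx
      simpa only [hUdef, iteratedDeriv_succ] using this
  have LV : ∀ j ≤ l, LipB a X δ₃ (-1 : ℝ) (V j) := by
    intro j hj
    refine LipB.of_deriv hC₁.le (fun ψ hψ x hx => ?_) (bV j (by omega)) (fun ψ hψ x hx => ?_)
    · exact (contDiffAt_iteratedDeriv j (hvx x (hIoo x hx) ψ hψ)).differentiableAt (by simp)
    · have := bV (j + 1) (by omega) ψ hψ x hx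
      simpa only [hVdef, iteratedDeriv_succ] using this
  have LU0 : LipB a X δ₃ ((1 : ℝ) / 2) u := by simpa [hUdef] using LU 0 (by omega)
  have LV0 : LipB a X δ₃ (-1 : ℝ) v := by simpa [hVdef] using LV 0 (by omega)
  have Linv : LipB a X δ₃ (-((1 : ℝ) / 2)) (fun x ψ => (u x ψ)⁻¹) :=
    LU0.inv hsm fun ψ hψ x hx => by
      rw [← Real.sqrt_eq_rpow]; exact hulow x hx ψ hψ
  set c : ℝ → ℝ → ℝ := fun x ψ => (1 / 2) * (v x ψ * (u x ψ)⁻¹) with hc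
  have Lc : LipB a X δ₃ (-1 + -((1 : ℝ) / 2)) c := (LV0.mul Linv).const_mul (1 / 2)
  set S : ℝ → ℝ → ℝ := fun x ψ => ∑ i ∈ Finset.range l,
    ((l + 1).choose (i + 1) : ℝ) * (U (i + 1) x ψ * U (l - i) x ψ) with hS
  have LS : LipB a X δ₃ ((1 : ℝ) / 2 + 1 / 2) S := LipB.sum _ fun i hi => by
    have := Finset.mem_range.1 hi
    exact ((LU (i + 1) (by omega)).mul (LU (l - i) (by omega))).const_mul _
  set S2 : ℝ → ℝ → ℝ := fun x ψ => ∑ i ∈ Finset.range l,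
    ((l + 1).choose (i + 1) : ℝ) * (U (i + 1) x ψ * V (l - i) x ψ) with hS2
  have LS2 : LipB a X δ₃ ((1 : ℝ) / 2 + -1) S2 := LipB.sum _ fun i hi => by
    have := Finset.mem_range.1 hi
    exact ((LU (i + 1) (by omega)).mul (LV (l - i) (by omega))).const_mul _
  set P : ℝ → ℝ → ℝ := fun x _ => iteratedDeriv (l + 1) (deriv p) x with hP
  have hp' : ∀ x, ContDiffAt ℝ (⊤ : ℕ∞) (deriv p) x := fun x => contDiffAt_deriv hw.hp.contDiffAt
  have LP : LipB a X δ₃ 0 P := by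
    have c1 : Continuous (iteratedDeriv (l + 1) (deriv p)) := continuous_iff_continuousAt.2
      fun x => (contDiffAt_iteratedDeriv (l + 1) (hp' x)).continuousAt
    have c2 : Continuous (iteratedDeriv (l + 2) (deriv p)) := continuous_iff_continuousAt.2
      fun x => (contDiffAt_iteratedDeriv (l + 2) (hp' x)).continuousAt
    obtain ⟨B1, hB1⟩ := (isCompact_Icc (a := a) (b := X)).exists_bound_of_continuousOn c1.continuousOn
    obtain ⟨B2, hB2⟩ := (isCompact_Icc (a := a) (b := X)).exists_bound_of_continuousOn c2.continuousOn
    refine LipB.of_deriv (C := max 0 (max B1 B2)) (le_max_left _ _) (fun ψ hψ x hx => ?_)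
      (fun ψ hψ x hx => ?_) (fun ψ hψ x hx => ?_)
    · exact (contDiffAt_iteratedDeriv (l + 1) (hp' x)).differentiableAt (by simp)
    · rw [Real.rpow_zero, mul_one]
      exact (hB1 x ⟨hx.1, hx.2.le⟩).trans ((le_max_left _ _).trans (le_max_right _ _))
    · rw [Real.rpow_zero, mul_one]
      have := (hB2 x ⟨hx.1, hx.2.le⟩).trans ((le_max_right B1 _).trans (le_max_right 0 _))
      rw [iteratedDeriv_succ] at this
      exact this
  set G : ℝ → ℝ → ℝ := fun x ψ => (S2 x ψ + (-2) * P x ψ) + (-1) * (c x ψ * S x ψ) with hG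
  have LG : LipB a X δ₃ (-(1 : ℝ) / 2) G :=
    ((LS2.mono hδ1 (by norm_num)).add ((LP.mono hδ1 (by norm_num)).const_mul _)).add
      (((Lc.mul LS).mono hδ1 (by norm_num)).const_mul _)
  set h : ℝ → ℝ → ℝ := fun x ψ => iteratedDeriv (l + 1) (fun x => w x ψ) x with hh
  have hhW : ∀ x ψ, h x ψ = (dX^[l + 1] (fun z : ℝ × ℝ => w z.1 z.2)) (x, ψ) := fun x ψ =>
    iter_eq (fun z : ℝ × ℝ => w z.1 z.2) (l + 1) x ψ
  have hhsm : ContDiffOn ℝ (⊤ : ℕ∞) (fun z : ℝ × ℝ => h z.1 z.2) (Ioo 0 X ×ˢ Ioi 0) :=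
    (smooth_iter hU hW (l + 1)).congr fun z _ => hhW z.1 z.2
  have hhyy : ∀ x ∈ Ioo 0 X, ∀ ψ ∈ Ioc 0 δ₃, deriv (deriv (h x)) ψ = V (l + 1) x ψ := by
    intro x hx ψ hψ
    have e1 : deriv (deriv (h x)) ψ
        = dY (dY (dX^[l + 1] (fun z : ℝ × ℝ => w z.1 z.2))) (x, ψ) := by
      have : h x = fun ψ => (dX^[l + 1] (fun z : ℝ × ℝ => w z.1 z.2)) (x, ψ) := funext (hhW x)
      rw [this]; rfl
    have hz : (x, ψ) ∈ Ioo (0 : ℝ) X ×ˢ Ioi (0 : ℝ) := ⟨hx, hψ.1⟩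
    rw [e1, congr_dY hU (comm_iter hU hW (l + 1)) hz, comm_iter hU (smooth_dY hU hW) (l + 1) hz,
      ← pd2_eq]
    rfl
  have hhx : ∀ x ψ, deriv (fun x => h x ψ) x = iteratedDeriv (l + 2) (fun x => w x ψ) x := by
    intro x ψ
    rw [iteratedDeriv_succ]
  -- products
  have hsq : ∀ n, ∀ x ∈ Ioo 0 X, ∀ ψ ∈ Ioc 0 δ₃,
      iteratedDeriv n (fun x => w x ψ) x = iteratedDeriv n (fun x => u x ψ * u x ψ) x := by
    intro n x hx ψ hψ
    apply Filter.EventuallyEq.iteratedDeriv_eq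
    filter_upwards [isOpen_Ioo.mem_nhds hx] with y hy
    exact (huu y hy ψ hψ).symm
  have heqn : ∀ x ∈ Ioo 0 X, ∀ ψ ∈ Ioc 0 δ₃,
      deriv (fun x => w x ψ) x = u x ψ * v x ψ - 2 * deriv p x := by
    intro x hx ψ hψ
    have := hw.eqn x ⟨hx.1, hx.2.le⟩ ψ hψ.1
    simp only [pd, iteratedDeriv_zero, iteratedDeriv_one] at this
    simp only [hu, hv]
    linarith
  have heq : ∀ x ∈ Ico a X, ∀ ψ ∈ Ioc 0 δ₃, deriv (fun x => h x ψ) x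
      = u x ψ * deriv (deriv (h x)) ψ + c x ψ * h x ψ + G x ψ := by
    intro x hx ψ hψ
    have hx' := hIoo x hx
    have e1 : deriv (fun x => h x ψ) x
        = iteratedDeriv (l + 1) (fun x => u x ψ * v x ψ) x - 2 * P x ψ := by
      rw [hhx, iteratedDeriv_succ']
      have e2 : deriv (fun x => w x ψ) =ᶠ[𝓝 x] fun x => u x ψ * v x ψ - 2 * deriv p x := by
        filter_upwards [isOpen_Ioo.mem_nhds hx'] with y hy using heqn y hy ψ hψ
      rw [e2.iteratedDeriv_eq, iteratedDeriv_fun_sub, iteratedDeriv_const_mul]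
      · exact contDiffAt_infty.1 (hp' x) _
      · exact contDiffAt_infty.1 ((hux x hx' ψ hψ).mul (hvx x hx' ψ hψ)) _
      · exact contDiffAt_infty.1 (contDiffAt_const.mul (hp' x)) _
    have e3 : h x ψ = u x ψ * U (l + 1) x ψ + U (l + 1) x ψ * u x ψ + S x ψ :=
      (hsq (l + 1) x hx' ψ hψ).trans (leibniz l (hux x hx' ψ hψ) (hux x hx' ψ hψ))
    have e4 : iteratedDeriv (l + 1) (fun x => u x ψ * v x ψ) x
        = u x ψ * V (l + 1) x ψ + U (l + 1) x ψ * v x ψ + S2 x ψ :=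
      leibniz l (hux x hx' ψ hψ) (hvx x hx' ψ hψ)
    have hne := (hupos x hx' ψ hψ).ne'
    rw [e1, e4, hhyy x hx' ψ hψ, e3]
    simp only [hG, hc]
    field_simp
    ring
  -- upper bound on c
  have hcK : ∀ x ∈ Ico a X, ∀ ψ ∈ Ioc 0 δ₃, c x ψ ≤ C₁ / (2 * m) := by
    intro x hx ψ hψ
    have hx' := hIoo x hx
    have e1 := ((hIH (x, ψ) (hmem x hx ψ hψ)).1 1 (by omega)).2.2.1
    simp only [pd, iteratedDeriv_zero, iteratedDeriv_one] at e1
    have e2 := heqn x hx' ψ hψ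
    have e3 : u x ψ * v x ψ ≤ C₁ * ψ := by
      have := hw.hfav x
      have := le_abs_self (deriv (fun x => w x ψ) x)
      linarith
    have hup := hupos x hx' ψ hψ
    have e4 : c x ψ = (u x ψ * v x ψ) / (2 * w x ψ) := by
      rw [← huu x hx' ψ hψ]; simp only [hc]; field_simp
    rw [e4]
    have hwp := hwpos x hx' ψ hψ
    rw [div_le_div_iff₀ (by positivity) (by positivity)]
    have := hwlow x hx' ψ hψ
    nlinarith
  obtain ⟨Cu, hCu, hLu⟩ := LU0
  obtain ⟨Cc, hCc, hLc⟩ := Lc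
  obtain ⟨CG, hCG, hLG⟩ := LG
  set C := C₁ + Cu + Cc + CG with hC
  have hC0 : 0 ≤ C := by linarith
  have gLu : ∀ ψ ∈ Ioc 0 δ₃, ∀ x ∈ Ico a X, ∀ y ∈ Ico a X,
      |u x ψ - u y ψ| ≤ C * √ψ * |x - y| := by
    intro ψ hψ x hx y hy
    have := (hLu ψ hψ x hx).2 y hy
    rw [← Real.sqrt_eq_rpow] at this
    refine this.trans ?_
    gcongr
    linarith
  have gLc : ∀ ψ ∈ Ioc 0 δ₃, ∀ x ∈ Ico a X, ∀ y ∈ Ico a X,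
      |c x ψ - c y ψ| * (ψ * √ψ) ≤ C * |x - y| := by
    intro ψ hψ x hx y hy
    have h1 := (hLc ψ hψ x hx).2 y hy
    have h2 : ψ ^ (-1 + -((1 : ℝ) / 2)) * (ψ * √ψ) = 1 := by
      rw [Real.sqrt_eq_rpow]
      nth_rw 2 [← Real.rpow_one ψ]
      rw [← Real.rpow_add hψ.1, ← Real.rpow_add hψ.1]
      norm_num
    have hψ0 := hψ.1
    calc |c x ψ - c y ψ| * (ψ * √ψ)
        ≤ Cc * ψ ^ (-1 + -((1 : ℝ) / 2)) * |x - y| * (ψ * √ψ) := by gcongr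
      _ = Cc * |x - y| * (ψ ^ (-1 + -((1 : ℝ) / 2)) * (ψ * √ψ)) := by ring
      _ = Cc * |x - y| := by rw [h2, mul_one]
      _ ≤ _ := by gcongr; linarith
  have gLG : ∀ ψ ∈ Ioc 0 δ₃, ∀ x ∈ Ico a X, ∀ y ∈ Ico a X,
      |G x ψ - G y ψ| * √ψ ≤ C * |x - y| := by
    intro ψ hψ x hx y hy
    have h1 := (hLG ψ hψ x hx).2 y hy
    calc |G x ψ - G y ψ| * √ψ
        ≤ CG * ψ ^ (-(1 : ℝ) / 2) * |x - y| * √ψ := by gcongr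
      _ = CG * |x - y| * (ψ ^ (-(1 : ℝ) / 2) * √ψ) := by ring
      _ = CG * |x - y| := by rw [rpow_neg_half hψ.1, mul_one]
      _ ≤ _ := by gcongr; linarith
  have gyy : ∀ x ∈ Ico a X, ∀ ψ ∈ Ioc 0 δ₃, |deriv (deriv (h x)) ψ| * ψ ≤ C := by
    intro x hx ψ hψ
    rw [hhyy x (hIoo x hx) ψ hψ]
    have h1 := bV (l + 1) le_rfl ψ hψ x hx
    have hψ0 := hψ.1
    rw [Real.rpow_neg_one] at h1
    calc |V (l + 1) x ψ| * ψ ≤ C₁ * ψ⁻¹ * ψ := by gcongr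
      _ = C₁ := by field_simp
      _ ≤ _ := by linarith
  have gh : ∀ x ∈ Ico a X, ∀ ψ ∈ Ioc 0 δ₃, |h x ψ| ≤ C * ψ := by
    intro x hx ψ hψ
    have h1 := ((hIH (x, ψ) (hmem x hx ψ hψ)).1 (l + 1) (by omega)).2.2.1
    simp only [pd, iteratedDeriv_zero] at h1
    have hψ0 := hψ.1
    exact h1.trans (by gcongr; linarith)
  have ghx : ∀ x ∈ Ico a X, ∀ ψ ∈ Ioc 0 δ₃, |deriv (fun x => h x ψ) x| * √ψ ≤ C := by
    intro x hx ψ hψ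
    have h1 := (hIH (x, ψ) (hmem x hx ψ hψ)).2
    simp only [pd, iteratedDeriv_zero] at h1
    rw [hhx]
    calc _ ≤ C₁ * ψ ^ (-(1 : ℝ) / 2) * √ψ := by gcongr
      _ = C₁ := by rw [mul_assoc, rpow_neg_half hψ.1, mul_one]
      _ ≤ _ := by linarith
  have hK0 : 0 ≤ C₁ / (2 * m) := by positivity
  obtain ⟨A1, hA1, hb1⟩ := core2 (x0 := 5 * ε / 8) ha0 (by linarith) (by linarith) hδ0 hδ1 hβ hβ1
    hsm hK0 hC0 hhsm heq hulow hcK gLu gLc gLG gyy gh ghx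
  have dneg : ∀ (ψ x : ℝ), deriv (fun x => - h x ψ) x = - deriv (fun x => h x ψ) x :=
    fun ψ x => deriv.fun_neg
  have ddneg : ∀ (x ψ : ℝ), deriv (deriv (fun ψ => - h x ψ)) ψ = - deriv (deriv (h x)) ψ := by
    intro x ψ
    have : deriv (fun ψ => - h x ψ) = fun ψ => - deriv (h x) ψ := funext fun ψ => deriv.fun_neg
    rw [this, deriv.fun_neg]
  obtain ⟨A2, hA2, hb2⟩ := core2 (h := fun x ψ => - h x ψ) (G := fun x ψ => - G x ψ)
    (u := u) (c := c)
    (x0 := 5 * ε / 8) ha0 (by linarith) (by linarith) hδ0 hδ1 hβ hβ1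
    hsm hK0 hC0 hhsm.neg (by
      intro x hx ψ hψ
      rw [dneg, ddneg, heq x hx ψ hψ]; ring) hulow hcK gLu gLc (by
      intro ψ hψ x hx y hy
      rw [neg_sub_neg, abs_sub_comm]
      exact gLG ψ hψ x hx y hy) (by
      intro x hx ψ hψ
      rw [ddneg, abs_neg]; exact gyy x hx ψ hψ) (by
      intro x hx ψ hψ
      rw [abs_neg]; exact gh x hx ψ hψ) (by
      intro x hx ψ hψ
      rw [dneg, abs_neg]; exact ghx x hx ψ hψ)
  set B := (A1 + A2) * (4 / ε) with hB
  have hB0 : 0 < B := by positivity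
  have first : ∀ x ∈ Ico (7 * ε / 8) X, ∀ ψ ∈ Ioc (0 : ℝ) δ₃,
      |iteratedDeriv (l + 2) (fun x => w x ψ) x| ≤ B * ψ ^ (1 - β) := by
    intro x hx ψ hψ
    have hx' : x ∈ Ioo (5 * ε / 8) X := ⟨by linarith [hx.1], hx.2⟩
    have h1 := hb1 x hx' ψ hψ
    have h2 := hb2 x hx' ψ hψ
    rw [dneg, hhx] at h2
    rw [hhx] at h1
    set f := iteratedDeriv (l + 2) (fun x => w x ψ) x
    have hp0 : 0 < ψ ^ (1 - β) := Real.rpow_pos_of_pos hψ.1 _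
    have q1 := mul_pos hA1 hp0
    have q2 := mul_pos hA2 hp0
    have hxε : ε / 4 ≤ x - 5 * ε / 8 := by linarith [hx.1]
    have h3 : |f| * (x - 5 * ε / 8) ≤ (A1 + A2) * ψ ^ (1 - β) := by
      rw [add_mul]
      rcases abs_cases f with ⟨h, _⟩ | ⟨h, _⟩ <;> rw [h] <;> linarith
    have h4 : |f| * (ε / 4) ≤ (A1 + A2) * ψ ^ (1 - β) :=
      le_trans (by gcongr) h3
    rw [← le_div_iff₀ (by positivity)] at h4
    refine h4.trans (le_of_eq ?_)
    rw [hB]; field_simp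
  set T : ℝ := ∑ i ∈ Finset.range (l + 1), ((l + 2).choose (i + 1) : ℝ) with hT
  have hT0 : 0 ≤ T := Finset.sum_nonneg fun i _ => by positivity
  refine ⟨B + (B + T * (C₁ * C₁)) / √m, by positivity, fun x hx ψ hψ => ⟨?_, ?_⟩⟩
  · have h1 := first x hx ψ hψ
    simp only [pd, iteratedDeriv_zero]
    refine h1.trans (mul_le_mul_of_nonneg_right ?_ (Real.rpow_nonneg hψ.1.le _))
    have : 0 ≤ (B + T * (C₁ * C₁)) / √m := by positivity
    linarith
  · have hxa : x ∈ Ico a X := ⟨by linarith [hx.1], hx.2⟩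
    have hx' := hIoo x hxa
    have h1 := first x hx ψ hψ
    have hp0 : 0 < ψ ^ (1 - β) := Real.rpow_pos_of_pos hψ.1 _
    have e3 : iteratedDeriv (l + 2) (fun x => w x ψ) x
        = u x ψ * U (l + 2) x ψ + U (l + 2) x ψ * u x ψ + ∑ i ∈ Finset.range (l + 1),
          ((l + 2).choose (i + 1) : ℝ) * (U (i + 1) x ψ * U (l + 1 - i) x ψ) :=
      (hsq (l + 2) x hx' ψ hψ).trans (leibniz (l + 1) (hux x hx' ψ hψ) (hux x hx' ψ hψ))
    have hSum : |∑ i ∈ Finset.range (l + 1),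
          ((l + 2).choose (i + 1) : ℝ) * (U (i + 1) x ψ * U (l + 1 - i) x ψ)|
        ≤ T * (C₁ * C₁) * ψ ^ (1 - β) := by
      refine (Finset.abs_sum_le_sum_abs _ _).trans ?_
      rw [hT, mul_assoc, Finset.sum_mul]
      refine Finset.sum_le_sum fun i hi => ?_
      have hi' := Finset.mem_range.1 hi
      rw [abs_mul, abs_mul, Nat.abs_cast]
      have b1 := bU (i + 1) (by omega) ψ hψ x hxa
      have b2 := bU (l + 1 - i) (by omega) ψ hψ x hxa
      have b3 : ψ ^ ((1 : ℝ) / 2) * ψ ^ ((1 : ℝ) / 2) = ψ := by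
        rw [← Real.rpow_add hψ.1]; norm_num
      have b0 : 0 ≤ ψ ^ ((1 : ℝ) / 2) := Real.rpow_nonneg hψ.1.le _
      refine mul_le_mul_of_nonneg_left ?_ (by positivity)
      calc |U (i + 1) x ψ| * |U (l + 1 - i) x ψ|
          ≤ (C₁ * ψ ^ ((1 : ℝ) / 2)) * (C₁ * ψ ^ ((1 : ℝ) / 2)) := by gcongr
        _ = C₁ * C₁ * (ψ ^ ((1 : ℝ) / 2) * ψ ^ ((1 : ℝ) / 2)) := by ring
        _ = C₁ * C₁ * ψ := by rw [b3]
        _ ≤ _ := by gcongr; exact le_rpow_sub hψ.1 (hψ.2.trans hδ1) hβ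
    set Sm := ∑ i ∈ Finset.range (l + 1),
          ((l + 2).choose (i + 1) : ℝ) * (U (i + 1) x ψ * U (l + 1 - i) x ψ)
    have hup := hupos x hx' ψ hψ
    have hsψ : 0 < √ψ := Real.sqrt_pos.2 hψ.1
    have f1 : |U (l + 2) x ψ| * (2 * u x ψ) ≤ (B + T * (C₁ * C₁)) * ψ ^ (1 - β) := by
      have : U (l + 2) x ψ * (2 * u x ψ) = iteratedDeriv (l + 2) (fun x => w x ψ) x - Sm := by
        rw [e3]; ring
      rw [← abs_of_pos (show 0 < 2 * u x ψ by positivity), ← abs_mul, this, add_mul]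
      exact (abs_sub _ _).trans (add_le_add h1 hSum)
    have f2 : |U (l + 2) x ψ| * (√m * √ψ) ≤ (B + T * (C₁ * C₁)) * ψ ^ (1 - β) := by
      refine le_trans ?_ f1
      have := hulow x hxa ψ hψ
      exact mul_le_mul_of_nonneg_left (by linarith) (abs_nonneg _)
    have f3 : ψ ^ ((1 : ℝ) - β) = ψ ^ ((1 : ℝ) / 2 - β) * √ψ := by
      rw [Real.sqrt_eq_rpow, ← Real.rpow_add hψ.1]; congr 1; ring
    have f4 : |U (l + 2) x ψ| ≤ (B + T * (C₁ * C₁)) / √m * ψ ^ ((1 : ℝ) / 2 - β) := by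
      rw [f3, ← mul_assoc, ← mul_assoc] at f2
      have f5 := le_of_mul_le_mul_right f2 hsψ
      rw [div_mul_eq_mul_div, le_div_iff₀ hsm]
      exact f5
    have f6 : |pd (l + 2) 0 u x ψ| = |U (l + 2) x ψ| := by simp [pd, hUdef]
    rw [f6]
    refine f4.trans (mul_le_mul_of_nonneg_right ?_ (Real.rpow_nonneg hψ.1.le _))
    linarith

end OS
/-- First step of the induction: under `(IH_k)` on `[ε/2,X] × (0,δ₃]`, for every
sufficiently small `β ∈ (0,1)` there is `M₁ > 0` with `|∂ₓ^k w| ≤ M₁ ψ^{1-β}` and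
`|∂ₓ^k √w| ≤ M₁ ψ^{1/2-β}` on `[7ε/8,X] × (0,δ₃]`. -/
theorem induction_step_one (X : ℝ) (p : ℝ → ℝ) (w : ℝ → ℝ → ℝ) (α m M C₀ δ₁ : ℝ)
    (hw : OleinikSolution X p w α m M C₀ δ₁)
    (ε : ℝ) (hε : 0 < ε) (hεX : ε < X) (k : ℕ) (hk : 2 ≤ k)
    (δ₃ : ℝ) (hδ₃ : δ₃ ∈ Set.Ioo (0 : ℝ) 1) (hδ₃δ₁ : δ₃ ≤ δ₁)
    (C₁ : ℝ) (hC₁ : 0 < C₁)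
    (hIH : IH k w (Set.Icc (ε / 2) X ×ˢ Set.Ioc (0 : ℝ) δ₃) C₁) :
    ∃ β₀ > 0, ∀ β : ℝ, 0 < β → β < β₀ → β < 1 →
      ∃ M₁ > 0,
        ∀ x ∈ Set.Icc (7 * ε / 8) X, ∀ ψ ∈ Set.Ioc (0 : ℝ) δ₃,
          |pd k 0 w x ψ| ≤ M₁ * ψ ^ ((1 : ℝ) - β) ∧
          |pd k 0 (fun x' ψ' => Real.sqrt (w x' ψ')) x ψ|
            ≤ M₁ * ψ ^ ((1 : ℝ) / 2 - β) := by
  obtain ⟨l, rfl⟩ : ∃ l, k = l + 2 := ⟨k - 2, by omega⟩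
  refine ⟨1, one_pos, fun β hβ hβ1 _ => ?_⟩
  obtain ⟨M₁, hM₁, hb⟩ := OS.interior hw hε hεX hδ₃ hδ₃δ₁ hC₁ hIH hβ hβ1
  refine ⟨M₁, hM₁, fun x hx ψ hψ => ?_⟩
  rcases hx.2.lt_or_eq with hlt | heq
  · exact hb x ⟨hx.1, hlt⟩ ψ hψ
  · subst heq
    have hW : ContDiffOn ℝ (⊤ : ℕ∞) (fun z : ℝ × ℝ => w z.1 z.2) (Ioo 0 x ×ˢ Ioi 0) :=
      hw.smooth.mono (prod_mono Ioo_subset_Ioc_self le_rfl)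
    have hlt : 7 * ε / 8 < x := by linarith
    have hs : ∀ y ∈ Ico (7 * ε / 8) x, ContDiffAt ℝ (⊤ : ℕ∞) (fun x => w x ψ) y := fun y hy =>
      OS.slice_x hW ⟨by linarith [hy.1], hy.2⟩ hψ.1
    constructor
    · simp only [pd, iteratedDeriv_zero]
      refine OS.endpoint (l + 1) hlt hs fun y hy => ?_
      simpa only [pd, iteratedDeriv_zero] using (hb y hy ψ hψ).1
    · simp only [pd, iteratedDeriv_zero]
      refine OS.endpoint (l + 1) hlt (fun y hy => (hs y hy).sqrt ?_) fun y hy => ?_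
      · have h1 := hw.growth_lb y ⟨by linarith [hy.1], hy.2.le⟩ ψ ⟨hψ.1, hψ.2.trans hδ₃δ₁⟩
        have h2 := mul_pos hw.hm hψ.1
        exact (h2.trans h1).ne'
      · simpa only [pd, iteratedDeriv_zero] using (hb y hy ψ hψ).2
end

section
/- Let w be an Oleinik solution on [0,X], let 0 < ε < X, let k ≥ 2 be an integer, and assume the induction hypothesis (IH_k) holds on [ε/2,X]×(0,δ₃] for some δ₃ ∈ (0,1) with δ₃ ≤ δ₁. Then there exists a constant C > 0, independent of ψ, such that for all (x,ψ) ∈ [15ε/16,X]×(0,δ₃]: |∂ₓ^k w(x,ψ)| ≤ C ψ and |∂ₓ^k √w(x,ψ)| ≤ C ψ^{1/2}. -/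
open Set

section Helpers
open Filter Topology


lemma second_deriv_nonpos {f f' : ℝ → ℝ} {f'' y : ℝ} (hmax : IsLocalMax f y)
    (h1 : ∀ᶠ z in 𝓝 y, HasDerivAt f (f' z) z) (h2 : HasDerivAt f' f'' y) : f'' ≤ 0 := by
  by_contra hpos
  push Not at hpos
  have hd : deriv f =ᶠ[𝓝 y] f' := h1.mono fun z hz => hz.deriv
  have hdd : deriv (deriv f) y = f'' := by rw [hd.deriv_eq, h2.deriv]
  have hmin : IsLocalMin f y := isLocalMin_of_deriv_deriv_pos (by rw [hdd]; exact hpos)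
    hmax.deriv_eq_zero h1.self_of_nhds.continuousAt
  have hconst : f =ᶠ[𝓝 y] fun _ => f y := by
    filter_upwards [hmax, hmin] with z a b using le_antisymm a b
  have h3 : deriv f =ᶠ[𝓝 y] fun _ => 0 := by
    have := hconst.deriv
    simpa using this
  have h4 := h3.deriv_eq
  rw [hdd] at h4
  simp at h4
  linarith

lemma max_principle {a b δ H : ℝ} (hH : 0 ≤ H) (u ux uy uyy : ℝ → ℝ → ℝ)
    (hc : ContinuousOn (fun z : ℝ × ℝ => u z.1 z.2) (Icc a b ×ˢ Ioc 0 δ))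
    (hx : ∀ x ∈ Ioc a b, ∀ ψ ∈ Ioo 0 δ, HasDerivAt (fun x => u x ψ) (ux x ψ) x)
    (hy : ∀ x ∈ Ioc a b, ∀ ψ ∈ Ioo 0 δ, HasDerivAt (fun ψ => u x ψ) (uy x ψ) ψ)
    (hyy : ∀ x ∈ Ioc a b, ∀ ψ ∈ Ioo 0 δ, HasDerivAt (fun ψ => uy x ψ) (uyy x ψ) ψ)
    (hneg : ∀ x ∈ Ioc a b, ∀ ψ ∈ Ioo 0 δ, 0 < u x ψ → uyy x ψ ≤ 0 → ux x ψ < 0)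
    (ha : ∀ ψ ∈ Ioc 0 δ, u a ψ ≤ 0)
    (hδ : ∀ x ∈ Icc a b, u x δ ≤ 0)
    (h0 : ∀ x ∈ Icc a b, ∀ ψ ∈ Ioc 0 δ, u x ψ ≤ H * ψ) :
    ∀ x ∈ Icc a b, ∀ ψ ∈ Ioc 0 δ, u x ψ ≤ 0 := by
  intro x0 hx0 ψ0 hψ0
  by_contra hpos
  push Not at hpos
  set e := u x0 ψ0 with he
  set ρ := min ψ0 (e / (2 * (H + 1))) with hρ
  have hρ0 : 0 < ρ := lt_min hψ0.1 (by positivity)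
  have hρe : H * ρ < e := by
    have h1 : ρ ≤ e / (2 * (H + 1)) := min_le_right _ _
    rw [le_div_iff₀ (by positivity)] at h1
    nlinarith
  have hρψ : ρ ≤ ψ0 := min_le_left _ _
  have hsub : Icc a b ×ˢ Icc ρ δ ⊆ Icc a b ×ˢ Ioc 0 δ := by
    rintro ⟨x, ψ⟩ ⟨h1, h2⟩
    exact ⟨h1, lt_of_lt_of_le hρ0 h2.1, h2.2⟩
  obtain ⟨⟨x, ψ⟩, hz, hmax⟩ := (isCompact_Icc.prod isCompact_Icc).exists_isMaxOn
    (⟨(x0, ψ0), hx0, hρψ, hψ0.2⟩ : (Icc a b ×ˢ Icc ρ δ).Nonempty) (hc.mono hsub)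
  have hge : e ≤ u x ψ := hmax (show (x0, ψ0) ∈ Icc a b ×ˢ Icc ρ δ from ⟨hx0, hρψ, hψ0.2⟩)
  obtain ⟨hzx, hzψ⟩ := hz
  simp only at hzx hzψ
  have hψ1 : ψ ∈ Ioc 0 δ := ⟨lt_of_lt_of_le hρ0 hzψ.1, hzψ.2⟩
  have hxa : a < x := by
    rcases hzx.1.lt_or_eq with h | h
    · exact h
    · have := ha ψ hψ1
      rw [h] at this; linarith
  have hψδ : ψ < δ := by
    rcases hzψ.2.lt_or_eq with h | h
    · exact h
    · have := hδ x hzx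
      rw [← h] at this; linarith
  have hρψ' : ρ < ψ := by
    rcases hzψ.1.lt_or_eq with h | h
    · exact h
    · have := h0 x hzx ψ hψ1
      rw [← h] at this; rw [← h] at hge; linarith
  have hxI : x ∈ Ioc a b := ⟨hxa, hzx.2⟩
  have hψI : ψ ∈ Ioo 0 δ := ⟨hψ1.1, hψδ⟩
  have h2 : uyy x ψ ≤ 0 := by
    refine second_deriv_nonpos (f := fun ψ => u x ψ) (f' := fun ψ => uy x ψ) (y := ψ) ?_ ?_
      (hyy x hxI ψ hψI)
    · filter_upwards [Ioo_mem_nhds hρψ' hψδ] with y hy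
      exact hmax (show (x, y) ∈ Icc a b ×ˢ Icc ρ δ from ⟨hzx, hy.1.le, hy.2.le⟩)
    · filter_upwards [Ioo_mem_nhds hψI.1 hψI.2] with y hy'
      exact hy x hxI y hy'
  have h3 := hneg x hxI ψ hψI (by linarith) h2
  have h4 := (hx x hxI ψ hψI).hasDerivWithinAt (s := Iio x)
  rw [hasDerivWithinAt_iff_tendsto_slope' (by simp)] at h4
  have h5 : 0 ≤ ux x ψ := by
    refine ge_of_tendsto h4 ?_
    filter_upwards [Ioo_mem_nhdsLT hxa] with y hy
    have := hmax (show (y, ψ) ∈ Icc a b ×ˢ Icc ρ δ from ⟨⟨hy.1.le, hy.2.le.trans hzx.2⟩, hzψ⟩)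
    simp only [mem_ofPred_eq] at this
    rw [slope_def_field]
    exact div_nonneg_of_nonpos (by linarith) (by linarith [hy.2])
  linarith

/-- barrier comparison -/
lemma barrier {a b δ H L K S σ l : ℝ} (hab : a ≤ b) (hL : b - a ≤ L) (hδ : 0 < δ) (hH : 0 ≤ H)
    (hK : 0 ≤ K) (hl : 0 ≤ l)
    (r B B1 B2 : ℝ → ℝ) (hr : ∀ ψ ∈ Ioc 0 δ, 0 < r ψ) (hB : ∀ ψ ∈ Ioc 0 δ, 0 < B ψ)
    (hBd : ∀ ψ ∈ Ioc 0 δ, HasDerivAt B (B1 ψ) ψ)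
    (hBdd : ∀ ψ ∈ Ioc 0 δ, HasDerivAt B1 (B2 ψ) ψ)
    (f fx fy fyy A c g : ℝ → ℝ → ℝ)
    (hc : ContinuousOn (fun z : ℝ × ℝ => f z.1 z.2) (Icc a b ×ˢ Ioc 0 δ))
    (hx : ∀ x ∈ Ioc a b, ∀ ψ ∈ Ioo 0 δ, HasDerivAt (fun x => f x ψ) (fx x ψ) x)
    (hy : ∀ x ∈ Ioc a b, ∀ ψ ∈ Ioo 0 δ, HasDerivAt (fun ψ => f x ψ) (fy x ψ) ψ)
    (hyy : ∀ x ∈ Ioc a b, ∀ ψ ∈ Ioo 0 δ, HasDerivAt (fun ψ => fy x ψ) (fyy x ψ) ψ)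
    (heq : ∀ x ∈ Ioc a b, ∀ ψ ∈ Ioo 0 δ,
      fx x ψ = A x ψ * fyy x ψ + c x ψ * f x ψ + g x ψ)
    (hA : ∀ x ∈ Ioc a b, ∀ ψ ∈ Ioo 0 δ, 0 ≤ A x ψ)
    (hAB : ∀ x ∈ Ioc a b, ∀ ψ ∈ Ioo 0 δ, A x ψ * B2 ψ ≤ - σ * r ψ)
    (hcl : ∀ x ∈ Ioc a b, ∀ ψ ∈ Ioo 0 δ, c x ψ ≤ l)
    (hg : ∀ x ∈ Ioc a b, ∀ ψ ∈ Ioo 0 δ, g x ψ ≤ K * r ψ)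
    (hf : ∀ x ∈ Icc a b, ∀ ψ ∈ Ioc 0 δ, f x ψ ≤ K * r ψ)
    (hfH : ∀ x ∈ Icc a b, ∀ ψ ∈ Ioc 0 δ, f x ψ ≤ H * ψ)
    (hS0 : 0 ≤ S) (hS1 : K * (1 + L) < S * σ) (hS2 : L * (K * r δ) ≤ S * B δ) :
    ∀ x ∈ Icc a b, ∀ ψ ∈ Ioc 0 δ, Real.exp (-l * (x - a)) * (x - a) * f x ψ ≤ S * B ψ := by
  have hLn : 0 ≤ L := by linarith
  have hθ : ∀ x ∈ Icc a b, 0 ≤ Real.exp (-l * (x - a)) * (x - a) ∧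
      Real.exp (-l * (x - a)) * (x - a) ≤ L ∧ Real.exp (-l * (x - a)) ≤ 1 := by
    intro x hx
    have h1 : 0 ≤ x - a := by linarith [hx.1]
    have h2 : Real.exp (-l * (x - a)) ≤ 1 := by
      rw [Real.exp_le_one_iff]; nlinarith
    refine ⟨by positivity, ?_, h2⟩
    have := hx.2
    nlinarith [Real.exp_pos (-l * (x - a))]
  have key := max_principle (a := a) (b := b) (δ := δ) (H := L * H) (by positivity)
    (fun x ψ => Real.exp (-l * (x - a)) * (x - a) * f x ψ - S * B ψ)
    (fun x ψ => (Real.exp (-l * (x - a)) - l * (Real.exp (-l * (x - a)) * (x - a))) * f x ψ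
      + Real.exp (-l * (x - a)) * (x - a) * fx x ψ)
    (fun x ψ => Real.exp (-l * (x - a)) * (x - a) * fy x ψ - S * B1 ψ)
    (fun x ψ => Real.exp (-l * (x - a)) * (x - a) * fyy x ψ - S * B2 ψ)
    ?_ ?_ ?_ ?_ ?_ ?_ ?_ ?_
  · intro x hx ψ hψ
    have := key x hx ψ hψ
    linarith
  · have hBc : ContinuousOn (fun z : ℝ × ℝ => B z.2) (Icc a b ×ˢ Ioc 0 δ) := by
      have : ContinuousOn B (Ioc 0 δ) := fun ψ hψ => (hBd ψ hψ).continuousAt.continuousWithinAt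
      exact this.comp continuousOn_snd (fun z hz => hz.2)
    refine ContinuousOn.sub (ContinuousOn.mul ?_ hc) (continuousOn_const.mul hBc)
    fun_prop
  · intro x hx' ψ hψ
    have h1 : HasDerivAt (fun x : ℝ => Real.exp (-l * (x - a)) * (x - a))
        (Real.exp (-l * (x - a)) - l * (Real.exp (-l * (x - a)) * (x - a))) x := by
      have h2 : HasDerivAt (fun x : ℝ => x - a) 1 x := (hasDerivAt_id x).sub_const a
      have := ((h2.const_mul (-l)).exp).mul h2
      refine this.congr_deriv ?_
      ring
    exact (h1.mul (hx x hx' ψ hψ)).sub_const _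
  · intro x hx' ψ hψ
    exact ((hy x hx' ψ hψ).const_mul _).sub ((hBd ψ ⟨hψ.1, hψ.2.le⟩).const_mul _)
  · intro x hx' ψ hψ
    exact ((hyy x hx' ψ hψ).const_mul _).sub ((hBdd ψ ⟨hψ.1, hψ.2.le⟩).const_mul _)
  · intro x hx' ψ hψ hu huyy
    have hψ' : ψ ∈ Ioc 0 δ := ⟨hψ.1, hψ.2.le⟩
    have hxI : x ∈ Icc a b := ⟨hx'.1.le, hx'.2⟩
    obtain ⟨t0, t1, t2⟩ := hθ x hxI
    have tE := (Real.exp_pos (-l * (x - a))).le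
    have e1 := heq x hx' ψ hψ
    have e2 := hA x hx' ψ hψ
    have e3 := hAB x hx' ψ hψ
    have e4 := hcl x hx' ψ hψ
    have e5 := hg x hx' ψ hψ
    have e6 := hf x hxI ψ hψ'
    have e7 := hr ψ hψ'
    have e8 := hB ψ hψ'
    set E := Real.exp (-l * (x - a)) with hE
    set θ := E * (x - a) with hθd
    rw [e1]
    have k1 : A x ψ * (θ * fyy x ψ) ≤ A x ψ * (S * B2 ψ) :=
      mul_le_mul_of_nonneg_left (by linarith) e2
    have k2 : A x ψ * (S * B2 ψ) ≤ S * (- σ * r ψ) := by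
      have := mul_le_mul_of_nonneg_left e3 hS0
      linarith
    have k3 : (c x ψ - l) * (θ * f x ψ) ≤ 0 := by
      have : 0 ≤ θ * f x ψ := by nlinarith
      exact mul_nonpos_of_nonpos_of_nonneg (by linarith) this
    have k4 : E * f x ψ ≤ K * r ψ := by
      calc E * f x ψ ≤ E * (K * r ψ) := mul_le_mul_of_nonneg_left e6 tE
        _ ≤ 1 * (K * r ψ) := mul_le_mul_of_nonneg_right t2 (by positivity)
        _ = _ := one_mul _
    have k5 : θ * g x ψ ≤ L * (K * r ψ) := by
      calc θ * g x ψ ≤ θ * (K * r ψ) := mul_le_mul_of_nonneg_left e5 t0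
        _ ≤ L * (K * r ψ) := mul_le_mul_of_nonneg_right t1 (by positivity)
    have k6 : K * (1 + L) * r ψ < S * σ * r ψ := mul_lt_mul_of_pos_right hS1 e7
    nlinarith
  · intro ψ hψ
    have := hB ψ hψ
    simp only [sub_self, mul_zero, zero_mul, zero_sub]
    have := mul_nonneg hS0 this.le
    linarith
  · intro x hx'
    obtain ⟨t0, t1, t2⟩ := hθ x hx'
    have e6 := hf x hx' δ ⟨hδ, le_rfl⟩
    have e7 := hr δ ⟨hδ, le_rfl⟩
    have : Real.exp (-l * (x - a)) * (x - a) * f x δ ≤ L * (K * r δ) :=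
      calc _ ≤ Real.exp (-l * (x - a)) * (x - a) * (K * r δ) := mul_le_mul_of_nonneg_left e6 t0
        _ ≤ L * (K * r δ) := mul_le_mul_of_nonneg_right t1 (by positivity)
    linarith
  · intro x hx' ψ hψ
    obtain ⟨t0, t1, t2⟩ := hθ x hx'
    have e6 := hfH x hx' ψ hψ
    have e8 := mul_nonneg hS0 (hB ψ hψ).le
    have : Real.exp (-l * (x - a)) * (x - a) * f x ψ ≤ L * (H * ψ) :=
      calc _ ≤ Real.exp (-l * (x - a)) * (x - a) * (H * ψ) := mul_le_mul_of_nonneg_left e6 t0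
        _ ≤ L * (H * ψ) := mul_le_mul_of_nonneg_right t1 (mul_nonneg hH hψ.1.le)
    linarith

lemma dq_bound {F F' : ℝ → ℝ} {x h K : ℝ} (hh : 0 < h)
    (hF : ∀ y ∈ Icc (x - h) x, HasDerivAt F (F' y) y) (hK : ∀ y ∈ Icc (x - h) x, |F' y| ≤ K) :
    |(F x - F (x - h)) / h| ≤ K := by
  have := (convex_Icc (x - h) x).norm_image_sub_le_of_norm_hasDerivWithin_le
    (f := F) (f' := F') (C := K) (fun y hy => (hF y hy).hasDerivWithinAt) (fun y hy => hK y hy)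
    (x := x - h) (y := x) ⟨le_rfl, by linarith⟩ ⟨by linarith, le_rfl⟩
  rw [abs_div, abs_of_pos hh, div_le_iff₀ hh]
  simpa [abs_of_pos hh] using this

lemma end_bound {φ : ℝ → ℝ} {n : ℕ} {c X K : ℝ} (hcX : c < X) (hK : 0 ≤ K)
    (hd : ∀ x ∈ Ioo c X, DifferentiableAt ℝ (iteratedDeriv n φ) x)
    (hb : ∀ x ∈ Ioo c X, |iteratedDeriv (n + 1) φ x| ≤ K) :
    |iteratedDeriv (n + 1) φ X| ≤ K := by
  rw [iteratedDeriv_succ] at hb ⊢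
  set G := iteratedDeriv n φ
  by_cases hG : DifferentiableAt ℝ G X
  · have h4 := hG.hasDerivAt.hasDerivWithinAt (s := Iio X)
    rw [hasDerivWithinAt_iff_tendsto_slope' (by simp)] at h4
    refine le_of_tendsto h4.abs ?_
    filter_upwards [Ioo_mem_nhdsLT hcX] with y hy
    obtain ⟨ξ, hξ, h⟩ := exists_deriv_eq_slope G hy.2 (by
      intro z hz
      rcases hz.2.lt_or_eq with h | h
      · exact (hd z ⟨hy.1.trans_le hz.1, h⟩).continuousAt.continuousWithinAt
      · rw [h]; exact hG.continuousAt.continuousWithinAt)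
      (fun z hz => (hd z ⟨hy.1.trans hz.1, hz.2⟩).differentiableWithinAt)
    rw [slope_comm, slope_def_field, ← h]
    exact hb ξ ⟨hy.1.trans hξ.1, hξ.2⟩
  · rw [deriv_zero_of_not_differentiableAt hG]; simpa using hK

structure Dat (X δ m : ℝ) (p : ℝ → ℝ) (P Q R T : ℕ → ℝ → ℝ → ℝ) : Prop where
  dP : ∀ j, ∀ x ∈ Ioo 0 X, ∀ ψ ∈ Ioc 0 δ, HasDerivAt (fun x => P j x ψ) (P (j + 1) x ψ) x
  dQ : ∀ j, ∀ x ∈ Ioo 0 X, ∀ ψ ∈ Ioc 0 δ, HasDerivAt (fun x => Q j x ψ) (Q (j + 1) x ψ) x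
  dT : ∀ j, ∀ x ∈ Ioo 0 X, ∀ ψ ∈ Ioc 0 δ, HasDerivAt (fun x => T j x ψ) (T (j + 1) x ψ) x
  yP : ∀ j, ∀ x ∈ Ioo 0 X, ∀ ψ ∈ Ioc 0 δ, HasDerivAt (fun ψ => P j x ψ) (R j x ψ) ψ
  yR : ∀ j, ∀ x ∈ Ioo 0 X, ∀ ψ ∈ Ioc 0 δ, HasDerivAt (fun ψ => R j x ψ) (T j x ψ) ψ
  cP : ∀ j, ContinuousOn (fun z : ℝ × ℝ => P j z.1 z.2) (Ioo 0 X ×ˢ Ioc 0 δ)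
  dp : ∀ j x, HasDerivAt (iteratedDeriv j p) (iteratedDeriv (j + 1) p x) x
  L1 : ∀ n, ∀ x ∈ Ioo 0 X, ∀ ψ ∈ Ioc 0 δ, P (n + 1) x ψ =
    (∑ j ∈ Finset.range (n + 1), (n.choose j : ℝ) * Q j x ψ * T (n - j) x ψ)
      - 2 * iteratedDeriv (n + 1) p x
  L2 : ∀ n, ∀ x ∈ Ioo 0 X, ∀ ψ ∈ Ioc 0 δ, P n x ψ =
    ∑ j ∈ Finset.range (n + 1), (n.choose j : ℝ) * Q j x ψ * Q (n - j) x ψ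
  fav : ∀ x, iteratedDeriv 1 p x ≤ 0
  Qlb : ∀ x ∈ Ioo 0 X, ∀ ψ ∈ Ioc 0 δ, √m * √ψ ≤ Q 0 x ψ

lemma sum_split (n : ℕ) (hn : 1 ≤ n) (F : ℕ → ℝ) :
    ∑ j ∈ Finset.range (n + 1), F j = F 0 + F n + ∑ j ∈ Finset.Ico 1 n, F j := by
  rw [Finset.sum_range_succ, Finset.range_eq_Ico, Finset.sum_eq_sum_Ico_succ_bot (by omega)]
  simp only [zero_add]
  ring

lemma alg_id (q0 q0' qn qn' tn tn' t0 t0' M M' pp pp' N N' h : ℝ) (hh : h ≠ 0) (hq : q0' ≠ 0) :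
    ((q0 * tn + qn * t0 + M - 2 * pp) - (q0' * tn' + qn' * t0' + M' - 2 * pp')) / h
     - q0 * ((tn - tn') / h) - t0' / (2 * q0') * (((2 * (q0 * qn) + N) - (2 * (q0' * qn') + N')) / h)
    = (q0 - q0') / h * tn' + (M - M') / h + qn * ((t0 - t0') / h) - 2 * ((pp - pp') / h)
      - (2 * ((q0 - q0') / h * qn) + (N - N') / h) * (t0' / (2 * q0')) := by
  field_simp
  ring

section
variable {X δ m : ℝ} {p : ℝ → ℝ} {P Q R T : ℕ → ℝ → ℝ → ℝ}

lemma Dat.L1' (D : Dat X δ m p P Q R T) {n : ℕ} (hn : 1 ≤ n) {x ψ : ℝ} (hx : x ∈ Ioo 0 X)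
    (hψ : ψ ∈ Ioc 0 δ) : P (n + 1) x ψ = Q 0 x ψ * T n x ψ + Q n x ψ * T 0 x ψ +
      (∑ j ∈ Finset.Ico 1 n, (n.choose j : ℝ) * Q j x ψ * T (n - j) x ψ)
      - 2 * iteratedDeriv (n + 1) p x := by
  rw [D.L1 n x hx ψ hψ, sum_split n hn]
  simp

lemma Dat.L2' (D : Dat X δ m p P Q R T) {n : ℕ} (hn : 1 ≤ n) {x ψ : ℝ} (hx : x ∈ Ioo 0 X)
    (hψ : ψ ∈ Ioc 0 δ) : P n x ψ = 2 * (Q 0 x ψ * Q n x ψ) +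
      (∑ j ∈ Finset.Ico 1 n, (n.choose j : ℝ) * Q j x ψ * Q (n - j) x ψ) := by
  rw [D.L2 n x hx ψ hψ, sum_split n hn]
  simp
  ring

lemma sum_deriv {n : ℕ} {U V : ℕ → ℝ → ℝ} {x : ℝ}
    (hU : ∀ j, HasDerivAt (U j) (U (j + 1) x) x) (hV : ∀ j, HasDerivAt (V j) (V (j + 1) x) x) :
    HasDerivAt (fun x => ∑ j ∈ Finset.Ico 1 n, (n.choose j : ℝ) * U j x * V (n - j) x)
      (∑ j ∈ Finset.Ico 1 n, (n.choose j : ℝ) *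
        (U (j + 1) x * V (n - j) x + U j x * V (n - j + 1) x)) x := by
  refine HasDerivAt.fun_sum fun j _ => ?_
  refine (((hU j).const_mul (n.choose j : ℝ)).mul (hV (n - j))).congr_deriv ?_
  ring

lemma sum_deriv_bound {n : ℕ} {U V : ℕ → ℝ} {a b : ℝ} (ha : 0 ≤ a)
    (hU : ∀ j ≤ n, |U j| ≤ a) (hV : ∀ j ≤ n, |V j| ≤ b) :
    |∑ j ∈ Finset.Ico 1 n, (n.choose j : ℝ) * (U (j + 1) * V (n - j) + U j * V (n - j + 1))|
     ≤ (∑ j ∈ Finset.Ico 1 n, (n.choose j : ℝ)) * (2 * (a * b)) := by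
  rw [Finset.sum_mul]
  refine (Finset.abs_sum_le_sum_abs _ _).trans (Finset.sum_le_sum fun j hj => ?_)
  rw [Finset.mem_Ico] at hj
  rw [abs_mul, Nat.abs_cast]
  refine mul_le_mul_of_nonneg_left ?_ (by positivity)
  have h1 : |U (j + 1) * V (n - j)| ≤ a * b := by
    rw [abs_mul]
    exact mul_le_mul (hU _ (by omega)) (hV _ (by omega)) (abs_nonneg _) ha
  have h2 : |U j * V (n - j + 1)| ≤ a * b := by
    rw [abs_mul]
    exact mul_le_mul (hU _ (by omega)) (hV _ (by omega)) (abs_nonneg _) ha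
  have := abs_add_le (U (j + 1) * V (n - j)) (U j * V (n - j + 1))
  linarith

lemma Dat.c_le (D : Dat X δ m p P Q R T) (hm : 0 < m) {K x ψ : ℝ} (hx : x ∈ Ioo 0 X)
    (hψ : ψ ∈ Ioc 0 δ) (hK : 0 < K) (hP : |P 1 x ψ| ≤ K * ψ) :
    T 0 x ψ / (2 * Q 0 x ψ) ≤ K / (2 * m) := by
  have h1 := D.L1 0 x hx ψ hψ
  simp at h1
  have h2 := D.fav x
  have h3 := D.Qlb x hx ψ hψ
  have hψ0 := hψ.1
  have h4 : 0 < √m * √ψ := by positivity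
  have h5 : 0 < Q 0 x ψ := h4.trans_le h3
  have h6 : m * ψ ≤ Q 0 x ψ ^ 2 := by
    have : (√m * √ψ) ^ 2 ≤ Q 0 x ψ ^ 2 := by gcongr
    rwa [mul_pow, Real.sq_sqrt hm.le, Real.sq_sqrt hψ0.le] at this
  have h7 : Q 0 x ψ * T 0 x ψ ≤ K * ψ := by
    have := (abs_le.1 hP).2
    simp at h2
    linarith
  rw [div_le_div_iff₀ (by positivity) (by positivity)]
  by_cases hT : T 0 x ψ ≤ 0
  · have : 0 ≤ K * (2 * Q 0 x ψ) := by positivity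
    nlinarith
  · push Not at hT
    have h8 : Q 0 x ψ * (T 0 x ψ * m) ≤ Q 0 x ψ * (K * Q 0 x ψ) := by
      calc Q 0 x ψ * (T 0 x ψ * m) = (Q 0 x ψ * T 0 x ψ) * m := by ring
        _ ≤ (K * ψ) * m := by gcongr
        _ = K * (m * ψ) := by ring
        _ ≤ K * Q 0 x ψ ^ 2 := by gcongr
        _ = _ := by ring
    have := le_of_mul_le_mul_left h8 h5
    linarith

lemma Dat.g_bound (D : Dat X δ m p P Q R T) (hm : 0 < m) {n : ℕ} (hn : 1 ≤ n)
    {K a x h ψ r N : ℝ} (ha : 0 < a) (hh : 0 < h) (hxa : a ≤ x - h) (hxX : x < X)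
    (hψ : ψ ∈ Ioc 0 δ) (hK : 0 < K) (hr : 1 ≤ r)
    (bQ : ∀ j ≤ n, ∀ x ∈ Ico a X, |Q j x ψ| ≤ K * √ψ)
    (bT : ∀ j ≤ n, ∀ x ∈ Ico a X, |T j x ψ| ≤ K * r / √ψ)
    (bp : ∀ j ≤ n + 2, ∀ x ∈ Icc 0 X, |iteratedDeriv j p x| ≤ K)
    (hN : N = ∑ j ∈ Finset.Ico 1 n, (n.choose j : ℝ)) :
    |(P (n + 1) x ψ - P (n + 1) (x - h) ψ) / h
     - Q 0 x ψ * ((T n x ψ - T n (x - h) ψ) / h)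
     - T 0 (x - h) ψ / (2 * Q 0 (x - h) ψ) * ((P n x ψ - P n (x - h) ψ) / h)| ≤
     (2 * K ^ 2 + 2 * N * K ^ 2 + 2 * K + (1 + N) * K ^ 3 / √m) * r := by
  have hψ0 := hψ.1
  have hs : 0 < √ψ := by positivity
  have hsm : 0 < √m := by positivity
  have hN0 : 0 ≤ N := by rw [hN]; positivity
  have hIx : ∀ y ∈ Icc (x - h) x, y ∈ Ico a X := fun y hy => ⟨hxa.trans hy.1, hy.2.trans_lt hxX⟩
  have hIo : ∀ y ∈ Icc (x - h) x, y ∈ Ioo 0 X :=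
    fun y hy => ⟨(ha.trans_le hxa).trans_le hy.1, hy.2.trans_lt hxX⟩
  have m1 : x ∈ Icc (x - h) x := ⟨by linarith, le_rfl⟩
  have m2 : x - h ∈ Icc (x - h) x := ⟨le_rfl, by linarith⟩
  have hQ0 : √m * √ψ ≤ Q 0 (x - h) ψ := D.Qlb _ (hIo _ m2) ψ hψ
  have hQp : 0 < Q 0 (x - h) ψ := lt_of_lt_of_le (by positivity) hQ0
  have hab : (K * √ψ) * (K * r / √ψ) = K ^ 2 * r := by field_simp
  have hss : √ψ * √ψ = ψ := Real.mul_self_sqrt hψ0.le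
  rw [D.L1' hn (hIo _ m1) hψ, D.L1' hn (hIo _ m2) hψ, D.L2' hn (hIo _ m1) hψ,
    D.L2' hn (hIo _ m2) hψ, alg_id _ _ _ _ _ _ _ _ _ _ _ _ _ _ _ hh.ne' hQp.ne']
  have b1 : |(Q 0 x ψ - Q 0 (x - h) ψ) / h| ≤ K * √ψ :=
    dq_bound (F := fun x => Q 0 x ψ) hh (fun y hy => D.dQ 0 y (hIo y hy) ψ hψ)
      (fun y hy => bQ 1 hn y (hIx y hy))
  have b2 : |(T 0 x ψ - T 0 (x - h) ψ) / h| ≤ K * r / √ψ :=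
    dq_bound (F := fun x => T 0 x ψ) hh (fun y hy => D.dT 0 y (hIo y hy) ψ hψ)
      (fun y hy => bT 1 hn y (hIx y hy))
  have b3 : |(iteratedDeriv (n + 1) p x - iteratedDeriv (n + 1) p (x - h)) / h| ≤ K :=
    dq_bound hh (fun y hy => D.dp (n + 1) y)
      (fun y hy => bp _ le_rfl y ⟨(hIo y hy).1.le, (hIo y hy).2.le⟩)
  have b4 := dq_bound (F := fun x => ∑ j ∈ Finset.Ico 1 n, (n.choose j : ℝ) * Q j x ψ * T (n - j) x ψ)
      (K := N * (2 * (K ^ 2 * r))) hh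
      (fun y hy => sum_deriv (n := n) (U := fun j x => Q j x ψ) (V := fun j x => T j x ψ)
        (fun j => D.dQ j y (hIo y hy) ψ hψ) (fun j => D.dT j y (hIo y hy) ψ hψ))
      (fun y hy => by
        have := sum_deriv_bound (n := n) (U := fun j => Q j y ψ) (V := fun j => T j y ψ)
          (a := K * √ψ) (b := K * r / √ψ) (by positivity)
          (fun j hj => bQ j hj y (hIx y hy)) (fun j hj => bT j hj y (hIx y hy))
        rwa [hab, ← hN] at this)
  have b5 := dq_bound (F := fun x => ∑ j ∈ Finset.Ico 1 n, (n.choose j : ℝ) * Q j x ψ * Q (n - j) x ψ)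
      (K := N * (2 * (K ^ 2 * ψ))) hh
      (fun y hy => sum_deriv (n := n) (U := fun j x => Q j x ψ) (V := fun j x => Q j x ψ)
        (fun j => D.dQ j y (hIo y hy) ψ hψ) (fun j => D.dQ j y (hIo y hy) ψ hψ))
      (fun y hy => by
        have := sum_deriv_bound (n := n) (U := fun j => Q j y ψ) (V := fun j => Q j y ψ)
          (a := K * √ψ) (b := K * √ψ) (by positivity)
          (fun j hj => bQ j hj y (hIx y hy)) (fun j hj => bQ j hj y (hIx y hy))
        rwa [show K * √ψ * (K * √ψ) = K ^ 2 * ψ by linear_combination K ^ 2 * hss, ← hN] at this)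
  have b6 : |T n (x - h) ψ| ≤ K * r / √ψ := bT n le_rfl _ (hIx _ m2)
  have b7 : |Q n x ψ| ≤ K * √ψ := bQ n le_rfl _ (hIx _ m1)
  have b8 : |T 0 (x - h) ψ / (2 * Q 0 (x - h) ψ)| ≤ K * r / (2 * √m * ψ) := by
    rw [abs_div, abs_of_pos (by positivity : 0 < 2 * Q 0 (x - h) ψ)]
    calc _ ≤ (K * r / √ψ) / (2 * (√m * √ψ)) :=
          div_le_div₀ (by positivity) (bT 0 (by omega) _ (hIx _ m2)) (by positivity)
            (by linarith)
      _ = K * r / (2 * √m * ψ) := by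
          nth_rewrite 3 [← hss]
          field_simp
  beta_reduce at b4 b5
  generalize (Q 0 x ψ - Q 0 (x - h) ψ) / h = z1 at *
  generalize (T 0 x ψ - T 0 (x - h) ψ) / h = z2 at *
  generalize (iteratedDeriv (n + 1) p x - iteratedDeriv (n + 1) p (x - h)) / h = z3 at *
  generalize T 0 (x - h) ψ / (2 * Q 0 (x - h) ψ) = z8 at *
  generalize (_ - _) / h = z4 at b4 ⊢
  generalize (_ - _) / h = z5 at b5 ⊢
  have c1 : |z1 * T n (x - h) ψ| ≤ K ^ 2 * r := by
    rw [abs_mul, ← hab]; exact mul_le_mul b1 b6 (abs_nonneg _) (by positivity)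
  have c2 : |Q n x ψ * z2| ≤ K ^ 2 * r := by
    rw [abs_mul, ← hab]; exact mul_le_mul b7 b2 (abs_nonneg _) (by positivity)
  have c3 : |z1 * Q n x ψ| ≤ K ^ 2 * ψ := by
    rw [abs_mul, show K ^ 2 * ψ = K * √ψ * (K * √ψ) by nth_rewrite 1 [← hss]; ring]
    exact mul_le_mul b1 b7 (abs_nonneg _) (by positivity)
  have c4 : |2 * (z1 * Q n x ψ) + z5| ≤ 2 * (1 + N) * K ^ 2 * ψ := by
    rw [abs_le] at c3 b5 ⊢
    constructor <;> nlinarith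
  have c5 : |(2 * (z1 * Q n x ψ) + z5) * z8| ≤ (1 + N) * K ^ 3 / √m * r := by
    rw [abs_mul]
    calc _ ≤ (2 * (1 + N) * K ^ 2 * ψ) * (K * r / (2 * √m * ψ)) :=
          mul_le_mul c4 b8 (abs_nonneg _) (by positivity)
      _ = _ := by field_simp
  have c6 : K ≤ K * r := by nlinarith
  rw [abs_le] at c1 c2 c5 b3 b4 ⊢
  constructor <;> nlinarith
end

section
variable {X δ m : ℝ} {p : ℝ → ℝ} {P Q R T : ℕ → ℝ → ℝ → ℝ}

lemma Dat.step (D : Dat X δ m p P Q R T) (hm : 0 < m) (hδ : 0 < δ) {n : ℕ} (hn : 1 ≤ n)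
    {K a1 a2 κ : ℝ} (ha1 : 0 < a1) (h12 : a1 < a2) (hK : 0 < K) (hκ : 0 < κ)
    (r B B1 B2 : ℝ → ℝ) (hr : ∀ ψ ∈ Ioc 0 δ, 1 ≤ r ψ) (hB : ∀ ψ ∈ Ioc 0 δ, 0 < B ψ)
    (hBd : ∀ ψ ∈ Ioc 0 δ, HasDerivAt B (B1 ψ) ψ)
    (hBdd : ∀ ψ ∈ Ioc 0 δ, HasDerivAt B1 (B2 ψ) ψ)
    (hB2 : ∀ ψ ∈ Ioc 0 δ, √ψ * B2 ψ ≤ -κ * r ψ)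
    (bQ : ∀ j ≤ n, ∀ x ∈ Ico a1 X, ∀ ψ ∈ Ioc 0 δ, |Q j x ψ| ≤ K * √ψ)
    (bP : ∀ j ≤ n, ∀ x ∈ Ico a1 X, ∀ ψ ∈ Ioc 0 δ, |P j x ψ| ≤ K * ψ)
    (bT : ∀ j ≤ n, ∀ x ∈ Ico a1 X, ∀ ψ ∈ Ioc 0 δ, |T j x ψ| ≤ K * r ψ / √ψ)
    (bk : ∀ x ∈ Ico a1 X, ∀ ψ ∈ Ioc 0 δ, |P (n + 1) x ψ| ≤ K * r ψ)
    (bp : ∀ j ≤ n + 2, ∀ x ∈ Icc 0 X, |iteratedDeriv j p x| ≤ K) :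
    ∃ C > 0, ∀ x ∈ Ico a2 X, ∀ ψ ∈ Ioc 0 δ, |P (n + 1) x ψ| ≤ C * B ψ := by
  obtain ⟨N, hN⟩ : ∃ N, N = ∑ j ∈ Finset.Ico 1 n, (n.choose j : ℝ) := ⟨_, rfl⟩
  have hN0 : 0 ≤ N := by rw [hN]; positivity
  by_cases hX : a2 < X
  swap
  · exact ⟨1, one_pos, fun x hx => absurd (hx.1.trans_lt hx.2) hX⟩
  have hX0 : 0 < X := by linarith
  obtain ⟨K', hK'⟩ : ∃ K', K' = K + (2 * K ^ 2 + 2 * N * K ^ 2 + 2 * K + (1 + N) * K ^ 3 / √m) :=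
    ⟨_, rfl⟩
  have hG0 : 0 ≤ 2 * K ^ 2 + 2 * N * K ^ 2 + 2 * K + (1 + N) * K ^ 3 / √m := by positivity
  have hK'0 : 0 < K' := by linarith
  have hδm : δ ∈ Ioc 0 δ := ⟨hδ, le_rfl⟩
  have hsm : 0 < √m := by positivity
  have hrδ := hr δ hδm
  have hBδ := hB δ hδm
  obtain ⟨S, hS⟩ : ∃ S, S = K' * (1 + X) / (κ * √m) + X * (K' * r δ) / B δ + 1 := ⟨_, rfl⟩
  have hS1' : 0 ≤ K' * (1 + X) / (κ * √m) := by positivity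
  have hS2' : 0 ≤ X * (K' * r δ) / B δ := by positivity
  have hS0 : 0 < S := by linarith
  have hS1 : K' * (1 + X) < S * (κ * √m) := by
    rw [← div_lt_iff₀ (by positivity)]; linarith
  have hS2 : X * (K' * r δ) ≤ S * B δ := by
    rw [← div_le_iff₀ (by positivity)]; linarith
  obtain ⟨a, ha⟩ : ∃ a, a = (a1 + a2) / 2 := ⟨_, rfl⟩
  obtain ⟨l, hl⟩ : ∃ l, l = K / (2 * m) := ⟨_, rfl⟩
  have hl0 : 0 < l := by rw [hl]; positivity
  obtain ⟨τ, hτ⟩ : ∃ τ, τ = Real.exp (-l * X) * (a2 - a) := ⟨_, rfl⟩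
  have hτ0 : 0 < τ := by rw [hτ]; exact mul_pos (Real.exp_pos _) (by linarith)
  -- bound for the difference quotients
  have main : ∀ h, 0 < h → h < a - a1 → ∀ x ∈ Ico a2 X, ∀ ψ ∈ Ioc 0 δ,
      |(P n x ψ - P n (x - h) ψ) / h| ≤ S / τ * B ψ := by
    intro h hh hha b hb ψ0 hψ0
    have hab : a < b := by linarith [hb.1]
    have hI : ∀ x ∈ Icc a b, x ∈ Ioo 0 X ∧ x - h ∈ Ioo 0 X ∧ x ∈ Ico a1 X ∧ x - h ∈ Ico a1 X := by
      intro x hx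
      have h1 := hx.1
      have h2 := hx.2
      have h3 := hb.2
      refine ⟨⟨?_, ?_⟩, ⟨?_, ?_⟩, ⟨?_, ?_⟩, ⟨?_, ?_⟩⟩ <;> linarith
    have hdx : ∀ F : ℕ → ℝ → ℝ → ℝ, ∀ j, (∀ x ∈ Ioo 0 X, ∀ ψ ∈ Ioc 0 δ,
        HasDerivAt (fun x => F j x ψ) (F (j + 1) x ψ) x) → ∀ x ∈ Icc a b, ∀ ψ ∈ Ioc 0 δ,
        HasDerivAt (fun x => (F j x ψ - F j (x - h) ψ) / h)
          ((F (j + 1) x ψ - F (j + 1) (x - h) ψ) / h) x := by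
      intro F j hF x hx ψ hψ
      have h1 := hF x (hI x hx).1 ψ hψ
      have h2 := (hF (x - h) (hI x hx).2.1 ψ hψ).comp_sub_const x h
      exact (h1.sub h2).div_const h
    have hfb : ∀ x ∈ Icc a b, ∀ ψ ∈ Ioc 0 δ, |(P n x ψ - P n (x - h) ψ) / h| ≤ K' * r ψ := by
      intro x hx ψ hψ
      refine (dq_bound (F := fun x => P n x ψ) hh
        (F' := fun x => P (n + 1) x ψ) (K := K * r ψ) ?_ ?_).trans ?_
      · intro y hy
        exact D.dP n y ⟨(hI x hx).2.1.1.trans_le hy.1, hy.2.trans_lt (hI x hx).1.2⟩ ψ hψ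
      · intro y hy
        exact bk y ⟨(hI x hx).2.2.2.1.trans hy.1, hy.2.trans_lt (hI x hx).1.2⟩ ψ hψ
      · have := hr ψ hψ
        gcongr
        linarith
    have hgb : ∀ x ∈ Icc a b, ∀ ψ ∈ Ioc 0 δ,
      |(P (n + 1) x ψ - P (n + 1) (x - h) ψ) / h
        - Q 0 x ψ * ((T n x ψ - T n (x - h) ψ) / h)
        - T 0 (x - h) ψ / (2 * Q 0 (x - h) ψ) * ((P n x ψ - P n (x - h) ψ) / h)| ≤ K' * r ψ := by
      intro x hx ψ hψ
      refine (D.g_bound hm hn ha1 hh (hI x hx).2.2.2.1 (hI x hx).1.2 hψ hK (hr ψ hψ)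
        (fun j hj x hx => bQ j hj x hx ψ hψ) (fun j hj x hx => bT j hj x hx ψ hψ) bp hN).trans ?_
      have := hr ψ hψ
      gcongr
      linarith
    have hfH : ∀ x ∈ Icc a b, ∀ ψ ∈ Ioc 0 δ, |(P n x ψ - P n (x - h) ψ) / h| ≤ 2 * K / h * ψ := by
      intro x hx ψ hψ
      have h1 := bP n le_rfl x (hI x hx).2.2.1 ψ hψ
      have h2 := bP n le_rfl (x - h) (hI x hx).2.2.2 ψ hψ
      rw [abs_div, abs_of_pos hh, div_le_iff₀ hh]
      have h3 := abs_sub (P n x ψ) (P n (x - h) ψ)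
      have h4 : 2 * K / h * ψ * h = 2 * K * ψ := by field_simp
      rw [h4]; linarith
    have hcont : ContinuousOn (fun z : ℝ × ℝ => (P n z.1 z.2 - P n (z.1 - h) z.2) / h)
        (Icc a b ×ˢ Ioc 0 δ) := by
      have h1 : ContinuousOn (fun z : ℝ × ℝ => P n z.1 z.2) (Icc a b ×ˢ Ioc 0 δ) :=
        (D.cP n).mono (fun z hz => ⟨(hI z.1 hz.1).1, hz.2⟩)
      have h2 : ContinuousOn (fun z : ℝ × ℝ => P n (z.1 - h) z.2) (Icc a b ×ˢ Ioc 0 δ) :=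
        (D.cP n).comp (f := fun z : ℝ × ℝ => (z.1 - h, z.2)) (by fun_prop)
          (fun z hz => ⟨(hI z.1 hz.1).2.1, hz.2⟩)
      exact (h1.sub h2).div_const h
    have hAB : ∀ x ∈ Ioc a b, ∀ ψ ∈ Ioo 0 δ, Q 0 x ψ * B2 ψ ≤ -(κ * √m) * r ψ := by
      intro x hx ψ hψ
      have hψ' : ψ ∈ Ioc 0 δ := ⟨hψ.1, hψ.2.le⟩
      have h1 := hB2 ψ hψ'
      have h2 := D.Qlb x (hI x ⟨hx.1.le, hx.2⟩).1 ψ hψ'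
      have h3 := hr ψ hψ'
      have h4 : 0 < √ψ := Real.sqrt_pos.2 hψ.1
      have h5 : B2 ψ ≤ 0 := by
        by_contra hc
        push Not at hc
        have : 0 < √ψ * B2 ψ := by positivity
        nlinarith
      calc Q 0 x ψ * B2 ψ ≤ (√m * √ψ) * B2 ψ := mul_le_mul_of_nonpos_right h2 h5
        _ = √m * (√ψ * B2 ψ) := by ring
        _ ≤ √m * (-κ * r ψ) := by gcongr
        _ = _ := by ring
    have hres : ∀ s : ℝ, |s| = 1 → Real.exp (-l * (b - a)) * (b - a) *
        (s * ((P n b ψ0 - P n (b - h) ψ0) / h)) ≤ S * B ψ0 := by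
      intro s hs
      have hsle : ∀ {z y : ℝ}, |z| ≤ y → s * z ≤ y := by
        intro z y hz
        calc s * z ≤ |s * z| := le_abs_self _
          _ = |z| := by rw [abs_mul, hs, one_mul]
          _ ≤ y := hz
      refine barrier (a := a) (b := b) (δ := δ) (H := 2 * K / h) (L := X) (K := K') (S := S)
        (σ := κ * √m) (l := l) hab.le (by linarith [hb.2]) hδ (by positivity) hK'0.le hl0.le
        r B B1 B2 (fun ψ hψ => by linarith [hr ψ hψ]) hB hBd hBdd
        (fun x ψ => s * ((P n x ψ - P n (x - h) ψ) / h))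
        (fun x ψ => s * ((P (n + 1) x ψ - P (n + 1) (x - h) ψ) / h))
        (fun x ψ => s * ((R n x ψ - R n (x - h) ψ) / h))
        (fun x ψ => s * ((T n x ψ - T n (x - h) ψ) / h))
        (fun x ψ => Q 0 x ψ) (fun x ψ => T 0 (x - h) ψ / (2 * Q 0 (x - h) ψ))
        (fun x ψ => s * ((P (n + 1) x ψ - P (n + 1) (x - h) ψ) / h
        - Q 0 x ψ * ((T n x ψ - T n (x - h) ψ) / h)
        - T 0 (x - h) ψ / (2 * Q 0 (x - h) ψ) * ((P n x ψ - P n (x - h) ψ) / h)))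
        (continuousOn_const.mul hcont) ?_ ?_ ?_ ?_ ?_ hAB ?_ ?_ ?_ ?_ hS0.le hS1 hS2 b
        ⟨hab.le, le_rfl⟩ ψ0 hψ0
      · intro x hx ψ hψ
        exact (hdx P n (D.dP n) x ⟨hx.1.le, hx.2⟩ ψ ⟨hψ.1, hψ.2.le⟩).const_mul s
      · intro x hx ψ hψ
        have hx' := hI x ⟨hx.1.le, hx.2⟩
        exact (((D.yP n x hx'.1 ψ ⟨hψ.1, hψ.2.le⟩).sub
          (D.yP n (x - h) hx'.2.1 ψ ⟨hψ.1, hψ.2.le⟩)).div_const h).const_mul s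
      · intro x hx ψ hψ
        have hx' := hI x ⟨hx.1.le, hx.2⟩
        exact (((D.yR n x hx'.1 ψ ⟨hψ.1, hψ.2.le⟩).sub
          (D.yR n (x - h) hx'.2.1 ψ ⟨hψ.1, hψ.2.le⟩)).div_const h).const_mul s
      · intro x hx ψ hψ
        ring
      · intro x hx ψ hψ
        have hx' := hI x ⟨hx.1.le, hx.2⟩
        exact le_trans (by positivity) (D.Qlb x hx'.1 ψ ⟨hψ.1, hψ.2.le⟩)
      · intro x hx ψ hψ
        have hx' := hI x ⟨hx.1.le, hx.2⟩
        rw [hl]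
        exact D.c_le hm hx'.2.1 ⟨hψ.1, hψ.2.le⟩ hK (bP 1 hn _ hx'.2.2.2 ψ ⟨hψ.1, hψ.2.le⟩)
      · intro x hx ψ hψ
        exact hsle (hgb x ⟨hx.1.le, hx.2⟩ ψ ⟨hψ.1, hψ.2.le⟩)
      · intro x hx ψ hψ
        exact hsle (hfb x hx ψ hψ)
      · intro x hx ψ hψ
        exact hsle (hfH x hx ψ hψ)
    have r1 := hres 1 (by simp)
    have r2 := hres (-1) (by simp)
    have hθ : τ ≤ Real.exp (-l * (b - a)) * (b - a) := by
      rw [hτ]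
      have := hb.1
      have h3 := hb.2
      refine mul_le_mul (Real.exp_le_exp.2 ?_) (by linarith) (by linarith) (Real.exp_pos _).le
      nlinarith
    generalize Real.exp (-l * (b - a)) * (b - a) = θ at *
    have hθ0 : 0 < θ := by linarith
    have r3 : θ * |(P n b ψ0 - P n (b - h) ψ0) / h| ≤ S * B ψ0 := by
      rcases abs_cases ((P n b ψ0 - P n (b - h) ψ0) / h) with h | h <;> rw [h.1] <;> linarith
    rw [div_mul_eq_mul_div, le_div_iff₀ hτ0]
    calc _ ≤ |(P n b ψ0 - P n (b - h) ψ0) / h| * θ := by gcongr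
      _ ≤ _ := by linarith
  refine ⟨S / τ, by positivity, fun x hx ψ hψ => ?_⟩
  have hxo : x ∈ Ioo 0 X := ⟨by linarith [hx.1], hx.2⟩
  have hd := (D.dP n x hxo ψ hψ).tendsto_slope_zero_left
  refine le_of_tendsto hd.abs ?_
  have hlt : -(a - a1) < 0 := by linarith
  filter_upwards [Ioo_mem_nhdsLT hlt] with t ht
  have := main (-t) (by linarith [ht.2]) (by linarith [ht.1]) x hx ψ hψ
  have ht0 : t ≠ 0 := ht.2.ne
  have e : t⁻¹ • (P n (x + t) ψ - P n x ψ) = (P n x ψ - P n (x - -t) ψ) / -t := by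
    rw [smul_eq_mul, sub_neg_eq_add]
    field_simp
    ring
  rw [e]
  exact this

lemma Dat.T_bound (D : Dat X δ m p P Q R T) (hm : 0 < m) {n : ℕ}
    {K a1 : ℝ} (ha1 : 0 < a1) (hK : 0 < K)
    (bQ : ∀ j ≤ n, ∀ x ∈ Ico a1 X, ∀ ψ ∈ Ioc 0 δ, |Q j x ψ| ≤ K * √ψ)
    (bP : ∀ j ≤ n + 1, ∀ x ∈ Ico a1 X, ∀ ψ ∈ Ioc 0 δ, |P j x ψ| ≤ K)
    (bp : ∀ j ≤ n + 1, ∀ x ∈ Icc 0 X, |iteratedDeriv j p x| ≤ K) :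
    ∃ C > 0, ∀ j ≤ n, ∀ x ∈ Ico a1 X, ∀ ψ ∈ Ioc 0 δ, |T j x ψ| ≤ C / √ψ := by
  suffices H : ∀ i ≤ n + 1, ∃ C > 0, ∀ j < i, ∀ x ∈ Ico a1 X, ∀ ψ ∈ Ioc 0 δ,
      |T j x ψ| ≤ C / √ψ by
    obtain ⟨C, hC, h⟩ := H (n + 1) le_rfl
    exact ⟨C, hC, fun j hj => h j (by omega)⟩
  intro i
  induction i with
  | zero => intro _; exact ⟨1, one_pos, fun j hj => absurd hj (by omega)⟩
  | succ i ih =>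
    intro hi
    obtain ⟨C, hC, h⟩ := ih (by omega)
    obtain ⟨N, hN⟩ : ∃ N, N = ∑ j ∈ Finset.range i, (i.choose (j + 1) : ℝ) := ⟨_, rfl⟩
    have hN0 : 0 ≤ N := by rw [hN]; positivity
    have hsm : 0 < √m := by positivity
    obtain ⟨E, hE⟩ : ∃ E, E = (K + 2 * K + N * (K * C)) / √m := ⟨_, rfl⟩
    have hE0 : 0 < E := by rw [hE]; positivity
    refine ⟨C + E, by positivity, fun j hj x hx ψ hψ => ?_⟩
    have hψ0 := hψ.1
    have hs : 0 < √ψ := by positivity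
    rcases Nat.lt_succ_iff_lt_or_eq.1 hj with hj | rfl
    · refine (h j hj x hx ψ hψ).trans ?_
      gcongr
      linarith
    · have hxo : x ∈ Ioo 0 X := ⟨ha1.trans_le hx.1, hx.2⟩
      have e1 := D.L1 j x hxo ψ hψ
      rw [Finset.sum_range_succ'] at e1
      simp only [Nat.choose_zero_right, Nat.cast_one, one_mul, Nat.sub_zero] at e1
      have e2 : |∑ i ∈ Finset.range j, (j.choose (i + 1) : ℝ) * Q (i + 1) x ψ
          * T (j - (i + 1)) x ψ| ≤ N * (K * C) := by
        rw [hN, Finset.sum_mul]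
        refine (Finset.abs_sum_le_sum_abs _ _).trans (Finset.sum_le_sum fun i hi => ?_)
        rw [Finset.mem_range] at hi
        rw [mul_assoc, abs_mul, Nat.abs_cast]
        refine mul_le_mul_of_nonneg_left ?_ (by positivity)
        rw [abs_mul]
        calc _ ≤ (K * √ψ) * (C / √ψ) := mul_le_mul (bQ _ (by omega) x hx ψ hψ)
              (h _ (by omega) x hx ψ hψ) (abs_nonneg _) (by positivity)
          _ = _ := by field_simp
      have e3 := bP (j + 1) (by omega) x hx ψ hψ
      have e4 := bp (j + 1) (by omega) x ⟨hxo.1.le, hxo.2.le⟩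
      have e5 := D.Qlb x hxo ψ hψ
      generalize (∑ i ∈ Finset.range j, (j.choose (i + 1) : ℝ) * Q (i + 1) x ψ
          * T (j - (i + 1)) x ψ) = Z at *
      have e6 : |Q 0 x ψ * T j x ψ| ≤ K + 2 * K + N * (K * C) := by
        have : Q 0 x ψ * T j x ψ = P (j + 1) x ψ - Z + 2 * iteratedDeriv (j + 1) p x := by linarith
        rw [this]
        rw [abs_le] at e2 e3 e4 ⊢
        constructor <;> linarith
      have hQ : 0 < Q 0 x ψ := lt_of_lt_of_le (by positivity) e5
      rw [abs_mul, abs_of_pos hQ] at e6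
      have e7 : √m * √ψ * |T j x ψ| ≤ K + 2 * K + N * (K * C) :=
        (mul_le_mul_of_nonneg_right e5 (abs_nonneg _)).trans e6
      have e8 : |T j x ψ| ≤ E / √ψ := by
        rw [hE, div_div, le_div_iff₀ (by positivity)]
        linarith
      refine e8.trans ?_
      gcongr
      linarith

lemma Dat.Q_bound (D : Dat X δ m p P Q R T) (hm : 0 < m) {n : ℕ} (hn : 1 ≤ n)
    {K a1 : ℝ} (ha1 : 0 < a1) (hK : 0 < K)
    (bQ : ∀ j < n, ∀ x ∈ Ico a1 X, ∀ ψ ∈ Ioc 0 δ, |Q j x ψ| ≤ K * √ψ)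
    (bP : ∀ x ∈ Ico a1 X, ∀ ψ ∈ Ioc 0 δ, |P n x ψ| ≤ K * ψ) :
    ∃ C > 0, ∀ x ∈ Ico a1 X, ∀ ψ ∈ Ioc 0 δ, |Q n x ψ| ≤ C * √ψ := by
  obtain ⟨N, hN⟩ : ∃ N, N = ∑ j ∈ Finset.Ico 1 n, (n.choose j : ℝ) := ⟨_, rfl⟩
  have hN0 : 0 ≤ N := by rw [hN]; positivity
  have hsm : 0 < √m := by positivity
  refine ⟨(K + N * K ^ 2) / (2 * √m), by positivity, fun x hx ψ hψ => ?_⟩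
  have hψ0 := hψ.1
  have hs : 0 < √ψ := by positivity
  have hss : √ψ * √ψ = ψ := Real.mul_self_sqrt hψ0.le
  have hxo : x ∈ Ioo 0 X := ⟨ha1.trans_le hx.1, hx.2⟩
  have e1 := D.L2' hn hxo hψ
  have e2 : |∑ j ∈ Finset.Ico 1 n, (n.choose j : ℝ) * Q j x ψ * Q (n - j) x ψ|
      ≤ N * (K ^ 2 * ψ) := by
    rw [hN, Finset.sum_mul]
    refine (Finset.abs_sum_le_sum_abs _ _).trans (Finset.sum_le_sum fun i hi => ?_)
    rw [Finset.mem_Ico] at hi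
    rw [mul_assoc, abs_mul, Nat.abs_cast]
    refine mul_le_mul_of_nonneg_left ?_ (by positivity)
    rw [abs_mul]
    calc _ ≤ (K * √ψ) * (K * √ψ) := mul_le_mul (bQ _ (by omega) x hx ψ hψ)
          (bQ _ (by omega) x hx ψ hψ) (abs_nonneg _) (by positivity)
      _ = _ := by linear_combination K ^ 2 * hss
  have e3 := bP x hx ψ hψ
  have e5 := D.Qlb x hxo ψ hψ
  generalize (∑ j ∈ Finset.Ico 1 n, (n.choose j : ℝ) * Q j x ψ * Q (n - j) x ψ) = Z at *
  have e6 : |Q 0 x ψ * Q n x ψ| ≤ (K + N * K ^ 2) * ψ / 2 := by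
    have : Q 0 x ψ * Q n x ψ = (P n x ψ - Z) / 2 := by linarith
    rw [this]
    rw [abs_le] at e2 e3 ⊢
    constructor <;> linarith
  have hQ : 0 < Q 0 x ψ := lt_of_lt_of_le (by positivity) e5
  rw [abs_mul, abs_of_pos hQ] at e6
  have e7 : √m * √ψ * |Q n x ψ| ≤ (K + N * K ^ 2) * ψ / 2 :=
    (mul_le_mul_of_nonneg_right e5 (abs_nonneg _)).trans e6
  rw [div_mul_eq_mul_div, le_div_iff₀ (by positivity)]
  refine le_of_mul_le_mul_left ?_ hs
  calc √ψ * (|Q n x ψ| * (2 * √m)) = 2 * (√m * √ψ * |Q n x ψ|) := by ring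
    _ ≤ (K + N * K ^ 2) * ψ := by linarith
    _ = _ := by linear_combination -(K + N * K ^ 2) * hss

lemma Dat.final (D : Dat X δ m p P Q R T) (hm : 0 < m) (hδ : 0 < δ) (hδ1 : δ < 1) {n : ℕ}
    (hn : 1 ≤ n) {K a1 a2 : ℝ} (ha1 : 0 < a1) (h12 : a1 < a2) (hK : 0 < K)
    (bQ : ∀ j ≤ n, ∀ x ∈ Ico a1 X, ∀ ψ ∈ Ioc 0 δ, |Q j x ψ| ≤ K * √ψ)
    (bP : ∀ j ≤ n, ∀ x ∈ Ico a1 X, ∀ ψ ∈ Ioc 0 δ, |P j x ψ| ≤ K * ψ)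
    (bT : ∀ j ≤ n, ∀ x ∈ Ico a1 X, ∀ ψ ∈ Ioc 0 δ, |T j x ψ| ≤ K * ψ⁻¹)
    (bk : ∀ x ∈ Ico a1 X, ∀ ψ ∈ Ioc 0 δ, |P (n + 1) x ψ| ≤ K * (√ψ)⁻¹)
    (bp : ∀ j ≤ n + 2, ∀ x ∈ Icc 0 X, |iteratedDeriv j p x| ≤ K) :
    ∃ C > 0, ∀ x ∈ Ico a2 X, ∀ ψ ∈ Ioc 0 δ, |P (n + 1) x ψ| ≤ C * ψ ∧
      |Q (n + 1) x ψ| ≤ C * √ψ := by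
  have hs : ∀ ψ ∈ Ioc 0 δ, 0 < √ψ ∧ √ψ ≤ 1 ∧ √ψ * √ψ = ψ := by
    intro ψ hψ
    refine ⟨Real.sqrt_pos.2 hψ.1, ?_, Real.mul_self_sqrt hψ.1.le⟩
    exact Real.sqrt_le_iff.2 ⟨by norm_num, by linarith [hψ.2]⟩
  have hsd : ∀ ψ ∈ Ioc 0 δ, HasDerivAt Real.sqrt (1 / (2 * √ψ)) ψ :=
    fun ψ hψ => Real.hasDerivAt_sqrt hψ.1.ne'
  obtain ⟨c, hc⟩ : ∃ c, c = (a1 + a2) / 2 := ⟨_, rfl⟩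
  have h1c : a1 < c := by linarith
  have h2c : c < a2 := by linarith
  obtain ⟨C, hC, s1⟩ := D.step hm hδ hn ha1 h1c hK (κ := 1 / 4) (by norm_num)
    (fun ψ => (√ψ)⁻¹) (fun ψ => √ψ) (fun ψ => (1 / 2) * (√ψ)⁻¹)
    (fun ψ => (1 / 2) * (-(1 / (2 * √ψ)) / √ψ ^ 2))
    (fun ψ hψ => (one_le_inv₀ (hs ψ hψ).1).2 (hs ψ hψ).2.1) (fun ψ hψ => (hs ψ hψ).1)
    (fun ψ hψ => (hsd ψ hψ).congr_deriv (by have := (hs ψ hψ).1; field_simp))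
    (fun ψ hψ => ((hsd ψ hψ).inv (hs ψ hψ).1.ne').const_mul _)
    (by
      intro ψ hψ
      obtain ⟨h1, h2, h3⟩ := hs ψ hψ
      have : √ψ * ((1 / 2) * (-(1 / (2 * √ψ)) / √ψ ^ 2)) = -(1 / 4) * ((√ψ)⁻¹ * (√ψ)⁻¹) := by
        field_simp; norm_num
      rw [this]
      have h4 : 1 ≤ (√ψ)⁻¹ := (one_le_inv₀ h1).2 h2
      nlinarith)
    bQ bP
    (by
      intro j hj x hx ψ hψ
      obtain ⟨h1, h2, h3⟩ := hs ψ hψ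
      refine (bT j hj x hx ψ hψ).trans (le_of_eq ?_)
      rw [← h3, Real.sqrt_mul_self h1.le]
      field_simp)
    bk bp
  have hcX : ∀ x ∈ Ico c X, x ∈ Ico a1 X := fun x hx => ⟨h1c.le.trans hx.1, hx.2⟩
  have hc0 : 0 < c := ha1.trans h1c
  have s1' : ∀ x ∈ Ico c X, ∀ ψ ∈ Ioc 0 δ, |P (n + 1) x ψ| ≤ K + C := by
    intro x hx ψ hψ
    have := s1 x hx ψ hψ
    obtain ⟨h1, h2, h3⟩ := hs ψ hψ
    nlinarith
  obtain ⟨C', hC', t1⟩ := D.T_bound hm (n := n) (K := K + C) hc0 (by positivity)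
    (fun j hj x hx ψ hψ => (bQ j hj x (hcX x hx) ψ hψ).trans (by gcongr; linarith))
    (by
      intro j hj x hx ψ hψ
      rcases Nat.le_succ_iff.1 hj with h | rfl
      · have := bP j h x (hcX x hx) ψ hψ
        have h1 := hψ.1
        have h2 := hψ.2
        nlinarith
      · exact s1' x hx ψ hψ)
    (fun j hj x hx => (bp j (by omega) x hx).trans (by linarith))
  have hKC : 0 < K + C + C' := by positivity
  obtain ⟨E, hE, s2⟩ := D.step hm hδ hn hc0 h2c hKC (κ := 3 / 4) (by norm_num)
    (fun ψ => 1) (fun ψ => 2 * ψ - ψ * √ψ) (fun ψ => 2 - 3 / 2 * √ψ)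
    (fun ψ => - (3 / 2 * (1 / (2 * √ψ)))) (fun _ _ => le_rfl)
    (fun ψ hψ => by
      obtain ⟨h1, h2, h3⟩ := hs ψ hψ
      have := hψ.1
      nlinarith)
    (fun ψ hψ => by
      obtain ⟨h1, h2, h3⟩ := hs ψ hψ
      refine (((hasDerivAt_id ψ).const_mul 2).sub ((hasDerivAt_id ψ).mul (hsd ψ hψ))).congr_deriv ?_
      simp only [id]
      nth_rewrite 2 [← h3]
      field_simp
      ring)
    (fun ψ hψ => (((hsd ψ hψ).const_mul (3 / 2)).const_sub 2))
    (by
      intro ψ hψ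
      obtain ⟨h1, h2, h3⟩ := hs ψ hψ
      apply le_of_eq
      field_simp; norm_num)
    (fun j hj x hx ψ hψ => (bQ j hj x (hcX x hx) ψ hψ).trans (by gcongr; linarith))
    (fun j hj x hx ψ hψ => (bP j hj x (hcX x hx) ψ hψ).trans
      (mul_le_mul_of_nonneg_right (by linarith) hψ.1.le))
    (fun j hj x hx ψ hψ => (t1 j hj x hx ψ hψ).trans (by gcongr; linarith))
    (fun x hx ψ hψ => (s1' x hx ψ hψ).trans (by linarith))
    (fun j hj x hx => (bp j (by omega) x hx).trans (by linarith))
  have haX : ∀ x ∈ Ico a2 X, x ∈ Ico a1 X := fun x hx => ⟨h12.le.trans hx.1, hx.2⟩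
  have s3 : ∀ x ∈ Ico a2 X, ∀ ψ ∈ Ioc 0 δ, |P (n + 1) x ψ| ≤ (K + 2 * E) * ψ := by
    intro x hx ψ hψ
    refine (s2 x hx ψ hψ).trans ?_
    obtain ⟨h1, h2, h3⟩ := hs ψ hψ
    have h4 := hψ.1
    have : 0 < E * (ψ * √ψ) := by positivity
    have : 0 < K * ψ := by positivity
    nlinarith
  obtain ⟨G, hG, q1⟩ := D.Q_bound hm (n := n + 1) (by omega) (K := K + 2 * E) (ha1.trans h12)
    (by positivity)
    (fun j hj x hx ψ hψ => (bQ j (by omega) x (haX x hx) ψ hψ).trans (by gcongr; linarith)) s3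
  refine ⟨K + 2 * E + G, by positivity, fun x hx ψ hψ => ⟨(s3 x hx ψ hψ).trans ?_,
    (q1 x hx ψ hψ).trans ?_⟩⟩
  · exact mul_le_mul_of_nonneg_right (by linarith) hψ.1.le
  · gcongr
    linarith

end

section Calc

/-- directional derivative -/
noncomputable def dv (v : ℝ × ℝ) (G : ℝ × ℝ → ℝ) (z : ℝ × ℝ) : ℝ := fderiv ℝ G z v

variable {U : Set (ℝ × ℝ)} {G H : ℝ × ℝ → ℝ}

lemma dv_smooth (hU : IsOpen U) (v : ℝ × ℝ) (hG : ContDiffOn ℝ (⊤ : ℕ∞) G U) :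
    ContDiffOn ℝ (⊤ : ℕ∞) (dv v G) U := by
  have : ContDiffOn ℝ (⊤ : ℕ∞) (fderiv ℝ G) U := hG.fderiv_of_isOpen hU (by simp)
  exact this.clm_apply contDiffOn_const

lemma dv_iter_smooth (hU : IsOpen U) (v : ℝ × ℝ) (j : ℕ) (hG : ContDiffOn ℝ (⊤ : ℕ∞) G U) :
    ContDiffOn ℝ (⊤ : ℕ∞) ((dv v)^[j] G) U := by
  induction j with
  | zero => simpa using hG
  | succ j ih => rw [Function.iterate_succ_apply']; exact dv_smooth hU v ih

lemma dv_congr (hU : IsOpen U) (v : ℝ × ℝ) (h : EqOn G H U) : EqOn (dv v G) (dv v H) U := by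
  intro z hz
  have : G =ᶠ[𝓝 z] H := by filter_upwards [hU.mem_nhds hz] with y hy using h hy
  simp only [dv, this.fderiv_eq]

lemma dv_comm (hU : IsOpen U) (u v : ℝ × ℝ) (hG : ContDiffOn ℝ (⊤ : ℕ∞) G U) :
    EqOn (dv u (dv v G)) (dv v (dv u G)) U := by
  intro z hz
  have hz' := hG.contDiffAt (hU.mem_nhds hz)
  have hs : IsSymmSndFDerivAt ℝ G z := hz'.isSymmSndFDerivAt (by simp only [minSmoothness_of_isRCLikeNormedField]; exact WithTop.coe_le_coe.2 (le_top : (2 : ℕ∞) ≤ ⊤))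
  have hf : ContDiffOn ℝ (⊤ : ℕ∞) (fderiv ℝ G) U := hG.fderiv_of_isOpen hU (by simp)
  have hd : DifferentiableAt ℝ (fderiv ℝ G) z :=
    (hf.contDiffAt (hU.mem_nhds hz)).differentiableAt (by simp)
  have key : ∀ a b : ℝ × ℝ, dv a (dv b G) z = fderiv ℝ (fderiv ℝ G) z a b := by
    intro a b
    have := (hd.hasFDerivAt.clm_apply (hasFDerivAt_const b z)).fderiv
    show fderiv ℝ (fun y => (fderiv ℝ G y) b) z a = _
    rw [this]
    simp
  rw [key, key]
  exact hs u v

lemma dv_comm_iter (hU : IsOpen U) (u v : ℝ × ℝ) (j : ℕ) (hG : ContDiffOn ℝ (⊤ : ℕ∞) G U) :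
    EqOn (dv u ((dv v)^[j] G)) ((dv v)^[j] (dv u G)) U := by
  induction j with
  | zero => intro z _; rfl
  | succ j ih =>
    intro z hz
    rw [Function.iterate_succ_apply', Function.iterate_succ_apply',
      dv_comm hU u v (dv_iter_smooth hU v j hG) hz]
    exact dv_congr hU v ih hz

lemma dv_x (hU : IsOpen U) (hG : ContDiffOn ℝ (⊤ : ℕ∞) G U) {x ψ : ℝ} (hz : (x, ψ) ∈ U) :
    HasDerivAt (fun x => G (x, ψ)) (dv (1, 0) G (x, ψ)) x := by
  have hd : DifferentiableAt ℝ G (x, ψ) :=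
    (hG.contDiffAt (hU.mem_nhds hz)).differentiableAt (by simp)
  exact hd.hasFDerivAt.comp_hasDerivAt x ((hasDerivAt_id x).prodMk (hasDerivAt_const x ψ))

lemma dv_y (hU : IsOpen U) (hG : ContDiffOn ℝ (⊤ : ℕ∞) G U) {x ψ : ℝ} (hz : (x, ψ) ∈ U) :
    HasDerivAt (fun ψ => G (x, ψ)) (dv (0, 1) G (x, ψ)) ψ := by
  have hd : DifferentiableAt ℝ G (x, ψ) :=
    (hG.contDiffAt (hU.mem_nhds hz)).differentiableAt (by simp)
  exact hd.hasFDerivAt.comp_hasDerivAt ψ ((hasDerivAt_const ψ x).prodMk (hasDerivAt_id ψ))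

lemma nhds_x (hU : IsOpen U) {x ψ : ℝ} (hz : (x, ψ) ∈ U) : ∀ᶠ y in 𝓝 x, (y, ψ) ∈ U :=
  (Continuous.prodMk_left ψ).continuousAt.eventually (hU.mem_nhds hz)

lemma nhds_y (hU : IsOpen U) {x ψ : ℝ} (hz : (x, ψ) ∈ U) : ∀ᶠ y in 𝓝 ψ, (x, y) ∈ U :=
  (Continuous.prodMk_right x).continuousAt.eventually (hU.mem_nhds hz)

variable {w : ℝ → ℝ → ℝ}

lemma pd_eq0 (hU : IsOpen U) (hw : ContDiffOn ℝ (⊤ : ℕ∞) (fun z : ℝ × ℝ => w z.1 z.2) U) (m : ℕ) :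
    ∀ x ψ, (x, ψ) ∈ U → iteratedDeriv m (w x) ψ =
      (dv (0, 1))^[m] (fun z : ℝ × ℝ => w z.1 z.2) (x, ψ) := by
  induction m with
  | zero => intro x ψ _; simp
  | succ m ih =>
    intro x ψ hz
    rw [iteratedDeriv_succ, Function.iterate_succ_apply',
      ← (dv_y hU (dv_iter_smooth hU _ m hw) hz).deriv]
    refine Filter.EventuallyEq.deriv_eq ?_
    filter_upwards [nhds_y hU hz] with y hy using ih x y hy

lemma pd_eq (hU : IsOpen U) (hw : ContDiffOn ℝ (⊤ : ℕ∞) (fun z : ℝ × ℝ => w z.1 z.2) U) (m j : ℕ) :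
    ∀ x ψ, (x, ψ) ∈ U → pd j m w x ψ =
      (dv (1, 0))^[j] ((dv (0, 1))^[m] (fun z : ℝ × ℝ => w z.1 z.2)) (x, ψ) := by
  induction j with
  | zero => intro x ψ hz; simpa [pd] using pd_eq0 hU hw m x ψ hz
  | succ j ih =>
    intro x ψ hz
    rw [pd, iteratedDeriv_succ, Function.iterate_succ_apply',
      ← (dv_x hU (dv_iter_smooth hU _ j (dv_iter_smooth hU _ m hw)) hz).deriv]
    refine Filter.EventuallyEq.deriv_eq ?_
    filter_upwards [nhds_x hU hz] with y hy using ih y ψ hy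

lemma pd_dx (hU : IsOpen U) (hw : ContDiffOn ℝ (⊤ : ℕ∞) (fun z : ℝ × ℝ => w z.1 z.2) U) (m j : ℕ)
    {x ψ : ℝ} (hz : (x, ψ) ∈ U) :
    HasDerivAt (fun x => pd j m w x ψ) (pd (j + 1) m w x ψ) x := by
  rw [pd_eq hU hw m (j + 1) x ψ hz, Function.iterate_succ_apply']
  refine (dv_x hU (dv_iter_smooth hU _ j (dv_iter_smooth hU _ m hw)) hz).congr_of_eventuallyEq ?_
  filter_upwards [nhds_x hU hz] with y hy using pd_eq hU hw m j y ψ hy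

lemma pd_dy (hU : IsOpen U) (hw : ContDiffOn ℝ (⊤ : ℕ∞) (fun z : ℝ × ℝ => w z.1 z.2) U) (m j : ℕ)
    {x ψ : ℝ} (hz : (x, ψ) ∈ U) :
    HasDerivAt (fun ψ => pd j m w x ψ) (pd j (m + 1) w x ψ) ψ := by
  rw [pd_eq hU hw (m + 1) j x ψ hz, Function.iterate_succ_apply',
    ← dv_comm_iter hU _ _ j (dv_iter_smooth hU _ m hw) hz]
  refine (dv_y hU (dv_iter_smooth hU _ j (dv_iter_smooth hU _ m hw)) hz).congr_of_eventuallyEq ?_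
  filter_upwards [nhds_y hU hz] with y hy using pd_eq hU hw m j x y hy

lemma pd_cont (hU : IsOpen U) (hw : ContDiffOn ℝ (⊤ : ℕ∞) (fun z : ℝ × ℝ => w z.1 z.2) U)
    (m j : ℕ) : ContinuousOn (fun z : ℝ × ℝ => pd j m w z.1 z.2) U :=
  (dv_iter_smooth hU _ j (dv_iter_smooth hU _ m hw)).continuousOn.congr
    (fun z hz => pd_eq hU hw m j z.1 z.2 hz)

lemma pd_smooth_x (hU : IsOpen U) (hw : ContDiffOn ℝ (⊤ : ℕ∞) (fun z : ℝ × ℝ => w z.1 z.2) U)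
    (m : ℕ) {x ψ : ℝ} (hz : (x, ψ) ∈ U) :
    ContDiffAt ℝ (⊤ : ℕ∞) (fun x => iteratedDeriv m (w x) ψ) x := by
  have h1 := (dv_iter_smooth hU (0, 1) m hw).contDiffAt (hU.mem_nhds hz)
  have h2 : ContDiffAt ℝ (⊤ : ℕ∞) (fun x => (dv (0, 1))^[m] (fun z : ℝ × ℝ => w z.1 z.2) (x, ψ)) x :=
    h1.comp x (f := fun x => (x, ψ)) (contDiffAt_id.prodMk contDiffAt_const)
  refine h2.congr_of_eventuallyEq ?_
  filter_upwards [nhds_x hU hz] with y hy using pd_eq0 hU hw m y ψ hy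

lemma iter_hasDeriv {f : ℝ → ℝ} {x : ℝ} (hf : ContDiffAt ℝ (⊤ : ℕ∞) f x) (j : ℕ) :
    HasDerivAt (iteratedDeriv j f) (iteratedDeriv (j + 1) f x) x := by
  rw [iteratedDeriv_succ]
  refine DifferentiableAt.hasDerivAt ?_
  have h : ContDiffAt ℝ (⊤ : ℕ∞) (iteratedDeriv j f) x := by
    induction j with
    | zero => simpa using hf
    | succ j ih =>
      rw [iteratedDeriv_succ]
      have h1 : ContDiffAt ℝ (⊤ : ℕ∞) (fderiv ℝ (iteratedDeriv j f)) x :=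
        ih.fderiv_right (by simp)
      have h2 : ContDiffAt ℝ (⊤ : ℕ∞) (fun y => fderiv ℝ (iteratedDeriv j f) y 1) x :=
        h1.clm_apply contDiffAt_const
      exact h2
  exact h.differentiableAt (by simp)
end Calc

lemma mkDat {X : ℝ} {p : ℝ → ℝ} {w : ℝ → ℝ → ℝ} {α m M C₀ δ₁ δ : ℝ}
    (hw : OleinikSolution X p w α m M C₀ δ₁) (hδ : δ ≤ δ₁) :
    Dat X δ m p (fun j => pd j 0 w) (fun j => pd j 0 (fun x' ψ' => Real.sqrt (w x' ψ')))
      (fun j => pd j 1 w) (fun j => pd j 2 w) := by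
  have hU : IsOpen (Ioo 0 X ×ˢ Ioi 0 : Set (ℝ × ℝ)) := isOpen_Ioo.prod isOpen_Ioi
  have hs : ContDiffOn ℝ (⊤ : ℕ∞) (fun z : ℝ × ℝ => w z.1 z.2) (Ioo 0 X ×ˢ Ioi 0) :=
    hw.smooth.mono (prod_mono Ioo_subset_Ioc_self le_rfl)
  have hm : ∀ {x ψ : ℝ}, x ∈ Ioo 0 X → ψ ∈ Ioc 0 δ → (x, ψ) ∈ (Ioo 0 X ×ˢ Ioi 0 : Set (ℝ × ℝ)) :=
    fun hx hψ => ⟨hx, hψ.1⟩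
  have hlb : ∀ {x ψ : ℝ}, x ∈ Ioo 0 X → ψ ∈ Ioc 0 δ → m * ψ < w x ψ :=
    fun {x ψ} hx hψ => hw.growth_lb x ⟨hx.1.le, hx.2.le⟩ ψ ⟨hψ.1, hψ.2.trans hδ⟩
  have hpos : ∀ {x ψ : ℝ}, x ∈ Ioo 0 X → ψ ∈ Ioc 0 δ → 0 < w x ψ :=
    fun hx hψ => (mul_pos hw.hm hψ.1).trans (hlb hx hψ)
  have hw0 : ∀ {x ψ : ℝ}, x ∈ Ioo 0 X → ψ ∈ Ioc 0 δ →
      ContDiffAt ℝ (⊤ : ℕ∞) (fun x => w x ψ) x := by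
    intro x ψ hx hψ
    simpa using pd_smooth_x hU hs 0 (hm hx hψ)
  have hq : ∀ {x ψ : ℝ}, x ∈ Ioo 0 X → ψ ∈ Ioc 0 δ →
      ContDiffAt ℝ (⊤ : ℕ∞) (fun x => √(w x ψ)) x := by
    intro x ψ hx hψ
    exact (hw0 hx hψ).sqrt (hpos hx hψ).ne'
  have hdp : ContDiff ℝ (⊤ : ℕ∞) (deriv p) := by
    have := hw.hp
    exact (contDiff_infty_iff_deriv.1 this).2
  constructor
  · intro j x hx ψ hψ
    exact pd_dx hU hs 0 j (hm hx hψ)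
  · intro j x hx ψ hψ
    simp only [pd, iteratedDeriv_zero]
    exact iter_hasDeriv (hq hx hψ) j
  · intro j x hx ψ hψ
    exact pd_dx hU hs 2 j (hm hx hψ)
  · intro j x hx ψ hψ
    exact pd_dy hU hs 0 j (hm hx hψ)
  · intro j x hx ψ hψ
    exact pd_dy hU hs 1 j (hm hx hψ)
  · intro j
    exact (pd_cont hU hs 0 j).mono (fun z hz => hm hz.1 hz.2)
  · intro j x
    exact iter_hasDeriv hw.hp.contDiffAt j
  · intro n x hx ψ hψ
    have hle : ((n : ℕ∞) : WithTop ℕ∞) ≤ ((⊤ : ℕ∞) : WithTop ℕ∞) := by exact_mod_cast le_top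
    have h1 := (hq hx hψ).of_le hle
    have h2 := (pd_smooth_x hU hs 2 (hm hx hψ)).of_le hle
    have h3 : ContDiffAt ℝ n (fun x => 2 * deriv p x) x :=
      (contDiffAt_const.mul hdp.contDiffAt).of_le hle
    have h12 : ContDiffAt ℝ n ((fun x => √(w x ψ)) * (fun x => iteratedDeriv 2 (w x) ψ)) x :=
      h1.mul h2
    have e : deriv (fun x => w x ψ) =ᶠ[𝓝 x]
        (fun x => √(w x ψ)) * (fun x => iteratedDeriv 2 (w x) ψ) - (fun x => 2 * deriv p x) := by
      filter_upwards [isOpen_Ioo.mem_nhds hx] with y hy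
      have := hw.eqn y ⟨hy.1, hy.2.le⟩ ψ hψ.1
      simp only [pd, iteratedDeriv_one, iteratedDeriv_zero] at this
      simp only [Pi.sub_apply, Pi.mul_apply]
      linarith
    simp only [pd, iteratedDeriv_zero]
    rw [iteratedDeriv_succ', e.iteratedDeriv_eq, iteratedDeriv_sub h12 h3,
      iteratedDeriv_mul h1 h2, iteratedDeriv_const_mul_field, iteratedDeriv_succ']
  · intro n x hx ψ hψ
    have hle : ((n : ℕ∞) : WithTop ℕ∞) ≤ ((⊤ : ℕ∞) : WithTop ℕ∞) := by exact_mod_cast le_top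
    have h1 := (hq hx hψ).of_le hle
    have e : (fun x => w x ψ) =ᶠ[𝓝 x] (fun x => √(w x ψ)) * (fun x => √(w x ψ)) := by
      filter_upwards [isOpen_Ioo.mem_nhds hx] with y hy
      simp only [Pi.mul_apply]
      rw [Real.mul_self_sqrt (hpos hy hψ).le]
    simp only [pd, iteratedDeriv_zero]
    rw [e.iteratedDeriv_eq, iteratedDeriv_mul h1 h1]
  · intro x
    rw [iteratedDeriv_one]
    exact hw.hfav x
  · intro x hx ψ hψ
    simp only [pd, iteratedDeriv_zero]
    rw [← Real.sqrt_mul hw.hm.le]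
    exact Real.sqrt_le_sqrt (hlb hx hψ).le

lemma p_bound {p : ℝ → ℝ} (hp : ContDiff ℝ (⊤ : ℕ∞) p) (X : ℝ) (N : ℕ) :
    ∃ K > 0, ∀ j ≤ N, ∀ x ∈ Icc 0 X, |iteratedDeriv j p x| ≤ K := by
  have h : ∀ j, ∃ K, ∀ x ∈ Icc 0 X, |iteratedDeriv j p x| ≤ K := by
    intro j
    have hc : Continuous (iteratedDeriv j p) :=
      continuous_iff_continuousAt.2 fun x => (iter_hasDeriv hp.contDiffAt j).continuousAt
    exact isCompact_Icc.exists_bound_of_continuousOn (s := Icc 0 X) hc.continuousOn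
  choose K hK using h
  refine ⟨∑ j ∈ Finset.range (N + 1), |K j| + 1, by positivity, fun j hj x hx => ?_⟩
  have h1 := hK j x hx
  have h2 : |K j| ≤ ∑ j ∈ Finset.range (N + 1), |K j| :=
    Finset.single_le_sum (f := fun j => |K j|) (fun i _ => abs_nonneg _)
      (Finset.mem_range.2 (by omega))
  linarith [le_abs_self (K j)]

end Helpers

/-- Second step of the induction: under `(IH_k)` on `[ε/2,X] × (0,δ₃]`, there is
`C > 0` with `|∂ₓ^k w| ≤ C ψ` and `|∂ₓ^k √w| ≤ C ψ^{1/2}` on `[15ε/16,X] × (0,δ₃]`. -/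
theorem induction_step_two (X : ℝ) (p : ℝ → ℝ) (w : ℝ → ℝ → ℝ) (α m M C₀ δ₁ : ℝ)
    (hw : OleinikSolution X p w α m M C₀ δ₁)
    (ε : ℝ) (hε : 0 < ε) (hεX : ε < X) (k : ℕ) (hk : 2 ≤ k)
    (δ₃ : ℝ) (hδ₃ : δ₃ ∈ Set.Ioo (0 : ℝ) 1) (hδ₃δ₁ : δ₃ ≤ δ₁)
    (C₁ : ℝ) (hC₁ : 0 < C₁)
    (hIH : IH k w (Set.Icc (ε / 2) X ×ˢ Set.Ioc (0 : ℝ) δ₃) C₁) :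
    ∃ C > 0,
      ∀ x ∈ Set.Icc (15 * ε / 16) X, ∀ ψ ∈ Set.Ioc (0 : ℝ) δ₃,
        |pd k 0 w x ψ| ≤ C * ψ ∧
        |pd k 0 (fun x' ψ' => Real.sqrt (w x' ψ')) x ψ| ≤ C * ψ ^ ((1 : ℝ) / 2) := by
  obtain ⟨n, rfl⟩ : ∃ n, k = n + 1 := ⟨k - 1, by omega⟩
  have hn : 1 ≤ n := by omega
  have D := mkDat hw hδ₃δ₁
  obtain ⟨Kp, hKp, bp⟩ := p_bound hw.hp X (n + 2)
  have hmem : ∀ {x ψ : ℝ}, x ∈ Ico (ε / 2) X → ψ ∈ Ioc 0 δ₃ →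
      (x, ψ) ∈ (Set.Icc (ε / 2) X ×ˢ Set.Ioc (0 : ℝ) δ₃) := fun hx hψ => ⟨⟨hx.1, hx.2.le⟩, hψ⟩
  have hC : C₁ ≤ C₁ + Kp := by linarith
  obtain ⟨C, hC0, h⟩ := D.final hw.hm hδ₃.1 hδ₃.2 hn (K := C₁ + Kp) (a1 := ε / 2)
    (a2 := 15 * ε / 16) (by linarith) (by linarith) (by linarith)
    (by
      intro j hj x hx ψ hψ
      have := ((hIH _ (hmem hx hψ)).1 j (by omega)).2.2.2
      rw [← Real.sqrt_eq_rpow] at this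
      exact this.trans (by gcongr))
    (by
      intro j hj x hx ψ hψ
      have := ((hIH _ (hmem hx hψ)).1 j (by omega)).2.2.1
      exact this.trans (mul_le_mul_of_nonneg_right hC hψ.1.le))
    (by
      intro j hj x hx ψ hψ
      have := ((hIH _ (hmem hx hψ)).1 j (by omega)).2.1
      exact this.trans (mul_le_mul_of_nonneg_right hC (inv_nonneg.2 hψ.1.le)))
    (by
      intro x hx ψ hψ
      have := (hIH _ (hmem hx hψ)).2
      have e : ψ ^ (-(1 : ℝ) / 2) = (√ψ)⁻¹ := by
        rw [Real.sqrt_eq_rpow, ← Real.rpow_neg hψ.1.le]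
        norm_num
      rw [e] at this
      exact this.trans (by gcongr))
    (fun j hj x hx => (bp j hj x hx).trans (by linarith))
  refine ⟨C, hC0, fun x hx ψ hψ => ?_⟩
  rw [← Real.sqrt_eq_rpow]
  rcases hx.2.lt_or_eq with hlt | rfl
  · exact h x ⟨hx.1, hlt⟩ ψ hψ
  · have hcX : 15 * ε / 16 < x := by linarith
    have hI : ∀ y ∈ Ioo (15 * ε / 16) x, y ∈ Ioo 0 x :=
      fun y hy => ⟨lt_trans (by positivity) hy.1, hy.2⟩
    constructor
    · exact end_bound hcX (mul_nonneg hC0.le hψ.1.le)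
        (fun y hy => (D.dP n y (hI y hy) ψ hψ).differentiableAt)
        (fun y hy => (h y ⟨hy.1.le, hy.2⟩ ψ hψ).1)
    · exact end_bound hcX (by positivity)
        (fun y hy => (D.dQ n y (hI y hy) ψ hψ).differentiableAt)
        (fun y hy => (h y ⟨hy.1.le, hy.2⟩ ψ hψ).2)
end
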